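/- arXiv:1801.08850 — 13 statements merged into one kernel-verified Lean document; each statement's English description precedes it below -/
import Mathlib

section
/- Let T₁, T₂ ⊆ [n] be disjoint sets such that the inequality ∑_{i∈T₁} x_i + 2∑_{i∈T₂} x_i ≥ 2 is valid for K. Set I := T₁ ∪ T₂, I₁ := {i ∈ I : p_i < β(I)}, and I₂ := I∖I₁. Then: (a) β(I) > 0; (b) T₁ ⊆ I₁ (equivalently, I₂ ⊆ T₂); and (c) the inequality ∑_{i∈I₁} x_i + 2∑_{i∈I₂} x_i ≥ 2 is valid for K. In particular, since its coefficient vector is componentwise at most that of the original inequality, every x ≥ 0 satisfying the new inequality satisfies the original one. -/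
open Finset

/-- The MinKnap feasible set `K = {x ∈ {0,1}^n : ∑ i, p i * x i ≥ 1}`. -/
def MinKnapK (n : ℕ) (p : Fin n → ℝ) : Set (Fin n → ℝ) :=
  {x | (∀ i, x i = 0 ∨ x i = 1) ∧ 1 ≤ ∑ i, p i * x i}

theorem stmt_1 (n : ℕ) (p : Fin n → ℝ) (hp : ∀ i, 0 ≤ p i ∧ p i ≤ 1)
    (T₁ T₂ : Finset (Fin n)) (hdisj : Disjoint T₁ T₂)
    (hvalid : ∀ x ∈ MinKnapK n p, 2 ≤ ∑ i ∈ T₁, x i + 2 * ∑ i ∈ T₂, x i)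
    (I : Finset (Fin n)) (hI : I = T₁ ∪ T₂)
    (βI : ℝ) (hβI : βI = 1 - ∑ i ∈ Iᶜ, p i)
    (I₁ I₂ : Finset (Fin n))
    (hI₁ : I₁ = I.filter fun i => p i < βI)
    (hI₂ : I₂ = I \ I₁) :
    -- (a) β(I) > 0
    0 < βI ∧
    -- (b) T₁ ⊆ I₁ (equivalently, I₂ ⊆ T₂)
    T₁ ⊆ I₁ ∧ I₂ ⊆ T₂ ∧
    -- (c) the inequality ∑_{i∈I₁} x i + 2 ∑_{i∈I₂} x i ≥ 2 is valid for K
    (∀ x ∈ MinKnapK n p, 2 ≤ ∑ i ∈ I₁, x i + 2 * ∑ i ∈ I₂, x i) ∧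
    -- in particular, every x ≥ 0 satisfying the new inequality satisfies the original one
    (∀ x : Fin n → ℝ, (∀ i, 0 ≤ x i) →
      2 ≤ ∑ i ∈ I₁, x i + 2 * ∑ i ∈ I₂, x i →
      2 ≤ ∑ i ∈ T₁, x i + 2 * ∑ i ∈ T₂, x i) := by
  have hset : ∀ S : Finset (Fin n), 1 ≤ ∑ i ∈ S, p i →
      2 ≤ #(T₁ ∩ S) + 2 * #(T₂ ∩ S) := by
    intro S hS
    have h := hvalid (fun i => if i ∈ S then 1 else 0)
      ⟨fun i => by by_cases h : i ∈ S <;> simp [h], by simpa using hS⟩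
    simp only [Finset.sum_ite_mem, Finset.sum_const, nsmul_eq_mul, mul_one] at h
    exact_mod_cast h
  have ha : 0 < βI := by
    by_contra hneg
    have h := hset Iᶜ (by linarith)
    have h1 : T₁ ∩ Iᶜ = ∅ := by subst hI; ext i; simp; tauto
    have h2 : T₂ ∩ Iᶜ = ∅ := by subst hI; ext i; simp; tauto
    simp [h1, h2] at h
  have hb : T₁ ⊆ I₁ := by
    intro i hi
    have hiI : i ∈ I := by simp [hI, hi]
    rw [hI₁, Finset.mem_filter]
    refine ⟨hiI, ?_⟩
    by_contra hneg
    have h := hset (insert i Iᶜ) (by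
      rw [Finset.sum_insert (by simpa using hiI)]; linarith)
    have h1 : T₁ ∩ insert i Iᶜ ⊆ {i} := by
      intro j hj
      simp [hI] at hj ⊢
      tauto
    have hi2 : i ∉ T₂ := Finset.disjoint_left.mp hdisj hi
    have h2 : T₂ ∩ insert i Iᶜ = ∅ := by
      ext j
      simp only [hI, Finset.mem_inter, Finset.mem_insert, Finset.mem_compl, Finset.mem_union,
        Finset.notMem_empty, iff_false]
      rintro ⟨hj, rfl | hj'⟩ <;> tauto
    have := Finset.card_le_card h1
    simp [h2] at h this
    omega
  have hb' : I₂ ⊆ T₂ := by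
    intro i hi
    rw [hI₂, Finset.mem_sdiff, hI, Finset.mem_union] at hi
    rcases hi with ⟨h | h, h'⟩
    · exact absurd (hb h) h'
    · exact h
  have hsub : I₁ ⊆ I := by rw [hI₁]; exact Finset.filter_subset _ _
  refine ⟨ha, hb, hb', ?_, ?_⟩
  · rintro x ⟨hx, hsum⟩
    have hx0 : ∀ i, 0 ≤ x i := fun i => by rcases hx i with h | h <;> simp [h]
    have hx1 : ∀ i, x i ≤ 1 := fun i => by rcases hx i with h | h <;> simp [h]
    have hn1 : 0 ≤ ∑ i ∈ I₁, x i := Finset.sum_nonneg fun i _ => hx0 i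
    by_cases hex : ∃ i ∈ I₂, x i = 1
    · obtain ⟨i, hi, hxi⟩ := hex
      have := Finset.single_le_sum (f := x) (fun j _ => hx0 j) hi
      linarith
    · push Not at hex
      have hz : ∀ i ∈ I₂, x i = 0 := fun i hi => (hx i).resolve_right (hex i hi)
      rw [Finset.sum_eq_zero hz]
      have e1 := Finset.sum_add_sum_compl I (fun i => p i * x i)
      have e2 : ∑ i ∈ Iᶜ, p i * x i ≤ ∑ i ∈ Iᶜ, p i :=
        Finset.sum_le_sum fun i _ => mul_le_of_le_one_right (hp i).1 (hx1 i)
      have e3 := Finset.sum_sdiff (f := fun i => p i * x i) hsub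
      rw [← hI₂, Finset.sum_eq_zero (s := I₂) (fun i hi => by rw [hz i hi, mul_zero])] at e3
      have e4 : βI ≤ ∑ i ∈ I₁, p i * x i := by linarith
      have c1 : ∃ i ∈ I₁, x i = 1 := by
        by_contra hno
        push Not at hno
        rw [Finset.sum_eq_zero (fun i hi => by
          rw [(hx i).resolve_right (hno i hi), mul_zero])] at e4
        linarith
      obtain ⟨i, hi, hxi⟩ := c1
      have hpi : p i < βI := by rw [hI₁] at hi; exact (Finset.mem_filter.mp hi).2
      have e5 := Finset.add_sum_erase I₁ (fun i => p i * x i) hi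
      have e6 := Finset.add_sum_erase I₁ x hi
      have c2 : ∃ j ∈ I₁.erase i, x j = 1 := by
        by_contra hno
        push Not at hno
        rw [Finset.sum_eq_zero (fun i hi => by
          rw [(hx i).resolve_right (hno i hi), mul_zero])] at e5
        simp only [hxi] at e5
        linarith
      obtain ⟨j, hj, hxj⟩ := c2
      have := Finset.single_le_sum (f := x) (fun j _ => hx0 j) hj
      linarith
  · intro x hx h
    have e1 := Finset.sum_sdiff (f := x) hsub
    rw [← hI₂] at e1
    have e2 := Finset.sum_union (f := x) hdisj
    rw [← hI] at e2
    have e3 : ∑ i ∈ I₂, x i ≤ ∑ i ∈ T₂, x i :=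
      Finset.sum_le_sum_of_subset_of_nonneg hb' fun i _ _ => hx i
    linarith
end

section
/- Let x ∈ ℝ^n with x ≥ 0 be a point that satisfies (a) every valid pitch-1 inequality of K of the form ∑_{i∈T} x_i ≥ 1 (T ⊆ [n]), and (b) every inequality of the form ∑_{i∈I₁} x_i + 2∑_{i∈I₂} x_i ≥ 2 where I ⊆ [n], |I| ≥ 2, I₁ := {i ∈ I : p_i < β(I)} ≠ ∅, and I₂ := I∖I₁. Then x satisfies every valid pitch-2 inequality of K. -/
open Finset

/-- The pitch of the inequality `∑ i ∈ T, w i * x i ≥ β`: the least `k` such that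
every `k`-element subset `S ⊆ T` satisfies `∑ i ∈ S, w i ≥ β`. -/
noncomputable def pitch {ι : Type*} (T : Finset ι) (w : ι → ℝ) (β : ℝ) : ℕ :=
  sInf {k : ℕ | ∀ S ⊆ T, S.card = k → β ≤ ∑ i ∈ S, w i}

theorem stmt_2 (n : ℕ) (p : Fin n → ℝ) (hp : ∀ i, 0 ≤ p i ∧ p i ≤ 1)
    (x : Fin n → ℝ) (hx : ∀ i, 0 ≤ x i)
    -- (a) x satisfies every valid pitch-1 inequality of the form ∑_{i∈T} x i ≥ 1
    (ha : ∀ T : Finset (Fin n), (∀ y ∈ MinKnapK n p, 1 ≤ ∑ i ∈ T, y i) →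
      1 ≤ ∑ i ∈ T, x i)
    -- (b) x satisfies every inequality ∑_{I₁} x i + 2 ∑_{I₂} x i ≥ 2 with
    --     I ⊆ [n], |I| ≥ 2, I₁ := {i ∈ I : p i < β(I)} ≠ ∅, I₂ := I \ I₁
    (hb : ∀ I : Finset (Fin n), 2 ≤ I.card →
      (I.filter fun i => p i < 1 - ∑ j ∈ Iᶜ, p j).Nonempty →
      2 ≤ ∑ i ∈ I.filter (fun i => p i < 1 - ∑ j ∈ Iᶜ, p j), x i
        + 2 * ∑ i ∈ I \ I.filter (fun i => p i < 1 - ∑ j ∈ Iᶜ, p j), x i) :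
    -- then x satisfies every valid pitch-2 inequality of K
    ∀ (T : Finset (Fin n)) (w : Fin n → ℝ) (β : ℝ),
      (∀ i ∈ T, 0 < w i) → 0 < β →
      (∀ y ∈ MinKnapK n p, β ≤ ∑ i ∈ T, w i * y i) →
      pitch T w β = 2 →
      β ≤ ∑ i ∈ T, w i * x i := by
  classical
  intro T w β hw hβ hval hpitch
  have h2 : ∀ S ⊆ T, S.card = 2 → β ≤ ∑ i ∈ S, w i := by
    have hne : {k : ℕ | ∀ S ⊆ T, S.card = k → β ≤ ∑ i ∈ S, w i}.Nonempty := by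
      apply Nat.nonempty_of_sInf_eq_succ (k := 1)
      exact hpitch
    have := Nat.sInf_mem hne
    unfold pitch at hpitch
    rw [hpitch] at this
    exact this
  have h1 : ∃ i ∈ T, w i < β := by
    by_contra! hcon
    have : pitch T w β ≤ 1 := by
      apply Nat.sInf_le
      intro S hS hc
      obtain ⟨a, rfl⟩ := Finset.card_eq_one.1 hc
      simpa using hcon a (hS (by simp))
    omega
  have hpair : ∀ i ∈ T, ∀ j ∈ T, i ≠ j → β ≤ w i + w j := by
    intro i hi j hj hij
    have := h2 {i, j} (by intro a; simp; rintro (rfl | rfl) <;> assumption)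
      (Finset.card_pair hij)
    rwa [Finset.sum_pair hij] at this
  -- K is nonempty
  have hK : 1 ≤ ∑ i, p i := by
    by_contra! hlt
    have := ha ∅ (by
      intro y hy
      exfalso
      obtain ⟨h01, hs⟩ := hy
      have : ∑ i, p i * y i ≤ ∑ i, p i := by
        apply Finset.sum_le_sum
        intro i _
        rcases h01 i with h | h <;> rw [h] <;> linarith [(hp i).1]
      linarith)
    simp at this
    linarith
  obtain ⟨m, hm, hmβ⟩ := h1
  have hcard : 2 ≤ T.card := by
    by_contra! hlt
    have hc : T.card = 1 := by
      have := Finset.card_pos.2 ⟨m, hm⟩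
      omega
    obtain ⟨a, rfl⟩ := Finset.card_eq_one.1 hc
    have := hval (fun _ => 1) ⟨fun _ => Or.inr rfl, by simpa using hK⟩
    simp at this hm
    subst hm
    linarith
  have hI2 : ∀ i ∈ T, ¬ p i < 1 - ∑ j ∈ Tᶜ, p j → β ≤ w i := by
    intro i hi hpi
    have := hval (fun j => if j ∈ insert i Tᶜ then 1 else 0) ⟨fun j => by
      by_cases h : j ∈ insert i Tᶜ
      · right; simp only [h, if_true]
      · left; simp only [h, if_false], by
      simp only [mul_ite, mul_one, mul_zero, Finset.sum_ite_mem, Finset.univ_inter]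
      rw [Finset.sum_insert (by simpa using hi)]
      linarith⟩
    simp only [mul_ite, mul_one, mul_zero, Finset.sum_ite_mem] at this
    have he : T ∩ insert i Tᶜ = {i} := by
      ext j
      simp only [Finset.mem_inter, Finset.mem_insert, Finset.mem_compl, Finset.mem_singleton]
      constructor
      · tauto
      · rintro rfl; tauto
    rw [he] at this
    simpa using this
  have hI1 : ∀ i ∈ T, w i < β → p i < 1 - ∑ j ∈ Tᶜ, p j := by
    intro i hi h
    by_contra hc
    linarith [hI2 i hi hc]
  have hB := hb T hcard ⟨m, Finset.mem_filter.2 ⟨hm, hI1 m hm hmβ⟩⟩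
  have hB' : 2 ≤ ∑ i ∈ T, (if p i < 1 - ∑ j ∈ Tᶜ, p j then x i else 2 * x i) := by
    rw [Finset.sum_ite, ← Finset.mul_sum, Finset.filter_not]
    exact hB
  by_cases hA : ∀ i ∈ T, β ≤ 2 * w i
  · have : β * ∑ i ∈ T, (if p i < 1 - ∑ j ∈ Tᶜ, p j then x i else 2 * x i)
        ≤ 2 * ∑ i ∈ T, w i * x i := by
      rw [Finset.mul_sum, Finset.mul_sum]
      apply Finset.sum_le_sum
      intro i hi
      split_ifs with h
      · nlinarith [hx i, hA i hi]
      · nlinarith [hx i, hI2 i hi h]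
    nlinarith
  · push Not at hA
    obtain ⟨l, hl, hlβ⟩ := hA
    have hwl := hw l hl
    have hP := ha (T.erase l) (by
      intro y hy
      have hv := hval y hy
      by_contra! hlt
      have hz : ∀ i ∈ T.erase l, y i = 0 := by
        intro i hi
        rcases hy.1 i with h | h
        · exact h
        · exfalso
          have := Finset.single_le_sum (f := y) (s := T.erase l)
            (fun j _ => by rcases hy.1 j with h | h <;> rw [h] <;> norm_num) hi
          linarith
      rw [← Finset.add_sum_erase T _ hl,
        Finset.sum_eq_zero (s := T.erase l) (fun i hi => by rw [hz i hi, mul_zero])] at hv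
      rcases hy.1 l with h | h <;> rw [h] at hv <;> linarith)
    rw [← Finset.add_sum_erase T _ hl] at hB' ⊢
    rw [if_pos (hI1 l hl (by linarith))] at hB'
    have key : w l * ∑ i ∈ T.erase l, (if p i < 1 - ∑ j ∈ Tᶜ, p j then x i else 2 * x i)
        + (β - 2 * w l) * ∑ i ∈ T.erase l, x i ≤ ∑ i ∈ T.erase l, w i * x i := by
      rw [Finset.mul_sum, Finset.mul_sum, ← Finset.sum_add_distrib]
      apply Finset.sum_le_sum
      intro i hi
      obtain ⟨hil, hiT⟩ := Finset.mem_erase.1 hi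
      split_ifs with h
      · nlinarith [hx i, hpair i hiT l hl hil]
      · nlinarith [hx i, hI2 i hiT h]
    have e1 := mul_le_mul_of_nonneg_left hB' hwl.le
    have e2 := mul_le_mul_of_nonneg_left hP (by linarith : 0 ≤ β - 2 * w l)
    linarith
end

section
/- Let x̄ ∈ ℝ^n with x̄ ≥ 0 and let α ∈ (0,1]. Let z ∈ {0,1}^n satisfy ∑_{i=1}^n p_i(1 − z_i) ≤ 1 − α, and set I := {i ∈ [n] : z_i = 1}. Then β(I) ≥ α, and ∑_{i∈I, p_i<β(I)} x̄_i + 2∑_{i∈I, p_i≥β(I)} x̄_i ≤ ∑_{i∈[n], p_i<α} x̄_i z_i + 2∑_{i∈[n], p_i≥α} x̄_i z_i; moreover, this last inequality holds with equality whenever β(I) = α. Consequently, if the optimal value of the integer program min{∑_{i: p_i<α} x̄_i z_i + 2∑_{i: p_i≥α} x̄_i z_i : ∑_i p_i(1−z_i) ≤ 1−α, z ∈ {0,1}^n} is strictly less than 2, then x̄ violates the pitch-2 inequality ∑_{i∈I₁} x_i + 2∑_{i∈I₂} x_i ≥ 2 with I given by an optimal z; and if the optimal value is at least 2 then x̄ satisfies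 all such inequalities over sets I with β(I) = α. -/
open Finset

/-- The left-hand side of the pitch-2 inequality associated to `I` (with threshold `β`),
evaluated at `xb`:  `∑_{i ∈ I, p i < β} xb i + 2 ∑_{i ∈ I, p i ≥ β} xb i`. -/
noncomputable def pitch2LHS (n : ℕ) (p : Fin n → ℝ) (I : Finset (Fin n)) (β : ℝ)
    (xb : Fin n → ℝ) : ℝ :=
  ∑ i ∈ I.filter (fun i => p i < β), xb i + 2 * ∑ i ∈ I.filter (fun i => β ≤ p i), xb i

/-- The objective `∑_{i: p i < α} xb i * z i + 2 ∑_{i: p i ≥ α} xb i * z i` of the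
separation integer program `P_α`. -/
noncomputable def sepObj (n : ℕ) (p : Fin n → ℝ) (α : ℝ) (xb z : Fin n → ℝ) : ℝ :=
  ∑ i ∈ univ.filter (fun i => p i < α), xb i * z i
    + 2 * ∑ i ∈ univ.filter (fun i => α ≤ p i), xb i * z i

lemma pitch2_aux (n : ℕ) (p : Fin n → ℝ) (I : Finset (Fin n)) (β : ℝ) (xb : Fin n → ℝ) :
    pitch2LHS n p I β xb
      = ∑ i, if i ∈ I then (if p i < β then xb i else 2 * xb i) else 0 := by
  unfold pitch2LHS
  rw [Finset.mul_sum, Finset.sum_filter, Finset.sum_filter, ← Finset.sum_add_distrib,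
    ← Finset.sum_filter, Finset.filter_mem_eq_inter, Finset.univ_inter]
  refine Finset.sum_congr rfl fun i _ => ?_
  by_cases h : p i < β
  · simp [h, not_le.mpr h]
  · simp [h, not_lt.mp h]

lemma sepObj_aux (n : ℕ) (p : Fin n → ℝ) (α : ℝ) (xb z : Fin n → ℝ)
    (hz : ∀ i, z i = 0 ∨ z i = 1) (I : Finset (Fin n)) (hI : ∀ i, i ∈ I ↔ z i = 1) :
    sepObj n p α xb z = pitch2LHS n p I α xb := by
  rw [pitch2_aux]
  unfold sepObj
  rw [Finset.mul_sum, Finset.sum_filter, Finset.sum_filter, ← Finset.sum_add_distrib]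
  refine Finset.sum_congr rfl fun i _ => ?_
  by_cases h : p i < α
  · rcases hz i with h1 | h1 <;> simp [h, not_le.mpr h, hI, h1]
  · rcases hz i with h1 | h1 <;> simp [h, not_lt.mp h, hI, h1]

lemma feas_aux (n : ℕ) (p z : Fin n → ℝ)
    (hz : ∀ i, z i = 0 ∨ z i = 1) (I : Finset (Fin n)) (hI : ∀ i, i ∈ I ↔ z i = 1) :
    ∑ i, p i * (1 - z i) = ∑ i ∈ Iᶜ, p i := by
  rw [← Finset.sum_subset (Finset.subset_univ Iᶜ)]
  · refine Finset.sum_congr rfl fun i hi => ?_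
    rw [Finset.mem_compl, hI] at hi
    rcases hz i with h1 | h1
    · simp [h1]
    · exact absurd h1 hi
  · intro i _ hi
    rw [Finset.mem_compl, not_not, hI] at hi
    simp [hi]

theorem stmt_3 (n : ℕ) (p : Fin n → ℝ) (hp : ∀ i, 0 ≤ p i ∧ p i ≤ 1)
    (xb : Fin n → ℝ) (hxb : ∀ i, 0 ≤ xb i)
    (α : ℝ) (hα0 : 0 < α) (hα1 : α ≤ 1)
    (z : Fin n → ℝ) (hz : ∀ i, z i = 0 ∨ z i = 1)
    (hzfeas : ∑ i, p i * (1 - z i) ≤ 1 - α)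
    (I : Finset (Fin n)) (hI : I = univ.filter fun i => z i = 1)
    (βI : ℝ) (hβI : βI = 1 - ∑ i ∈ Iᶜ, p i) :
    -- β(I) ≥ α
    α ≤ βI ∧
    -- the pitch-2 LHS at xb is at most the objective value of z
    pitch2LHS n p I βI xb ≤ sepObj n p α xb z ∧
    -- with equality whenever β(I) = α
    (βI = α → pitch2LHS n p I βI xb = sepObj n p α xb z) ∧
    -- consequently, if z is optimal for the IP:
    ((∀ z' : Fin n → ℝ, (∀ i, z' i = 0 ∨ z' i = 1) →
        ∑ i, p i * (1 - z' i) ≤ 1 - α → sepObj n p α xb z ≤ sepObj n p α xb z') →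
      -- if the optimal value is < 2, xb violates the pitch-2 inequality given by I
      ((sepObj n p α xb z < 2 → pitch2LHS n p I βI xb < 2) ∧
      -- if the optimal value is ≥ 2, xb satisfies all pitch-2 inequalities of sets I'
      -- with β(I') = α
       (2 ≤ sepObj n p α xb z →
        ∀ I' : Finset (Fin n), 1 - ∑ i ∈ I'ᶜ, p i = α →
          2 ≤ pitch2LHS n p I' α xb))) := by
  have hm : ∀ i, i ∈ I ↔ z i = 1 := by intro i; simp [hI]
  have hf := feas_aux n p z hz I hm
  have hs := sepObj_aux n p α xb z hz I hm
  have hβ : α ≤ βI := by linarith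
  have hle : pitch2LHS n p I βI xb ≤ sepObj n p α xb z := by
    rw [hs, pitch2_aux, pitch2_aux]
    refine Finset.sum_le_sum fun i _ => ?_
    have := hxb i
    split_ifs <;> linarith
  refine ⟨hβ, hle, fun h => by rw [hs, h], fun hopt => ⟨fun h => by linarith, fun h2 I' hI' => ?_⟩⟩
  have hz' : ∀ i, (fun i => if i ∈ I' then (1 : ℝ) else 0) i = 0 ∨
      (fun i => if i ∈ I' then (1 : ℝ) else 0) i = 1 := by
    intro i
    by_cases h : i ∈ I' <;> simp [h]
  have hm' : ∀ i, i ∈ I' ↔ (fun i => if i ∈ I' then (1 : ℝ) else 0) i = 1 := by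
    intro i
    by_cases h : i ∈ I' <;> simp [h]
  have hf' := feas_aux n p _ hz' I' hm'
  have hs' := sepObj_aux n p α xb _ hz' I' hm'
  rw [← hs']
  exact h2.trans (hopt _ hz' (by rw [hf']; linarith))
end

section
/- Let 0 < ε < 1 and let x̄ ∈ [0,1]^n be such that the point (1+ε)x̄ satisfies every valid pitch-1 inequality ∑_{i∈T} x_i ≥ 1 of K and every inequality ∑_{i∈I₁} x_i + 2∑_{i∈I₂} x_i ≥ 2 with I ⊆ [n], |I| ≥ 2, I₁ := {i ∈ I : p_i < β(I)} ≠ ∅, I₂ := I∖I₁. Define ȳ ∈ ℝ^n by ȳ_i := min{1, ((1+ε)/(1−ε)) x̄_i}. Then ȳ ∈ [0,1]^n and ȳ satisfies all of the above pitch-1 and pitch-2 inequalities. -/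
open Finset

theorem stmt_4 (n : ℕ) (p : Fin n → ℝ) (hp : ∀ i, 0 ≤ p i ∧ p i ≤ 1)
    (ε : ℝ) (hε0 : 0 < ε) (hε1 : ε < 1)
    (xb : Fin n → ℝ) (hxb : ∀ i, 0 ≤ xb i ∧ xb i ≤ 1)
    -- (1+ε)·xb satisfies every valid pitch-1 inequality ∑_{i∈T} x i ≥ 1 of K
    (hp1 : ∀ T : Finset (Fin n), (∀ y ∈ MinKnapK n p, 1 ≤ ∑ i ∈ T, y i) →
      1 ≤ ∑ i ∈ T, (1 + ε) * xb i)
    -- (1+ε)·xb satisfies every inequality ∑_{I₁} x i + 2 ∑_{I₂} x i ≥ 2 with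
    -- I ⊆ [n], |I| ≥ 2, I₁ := {i ∈ I : p i < β(I)} ≠ ∅, I₂ := I \ I₁
    (hp2 : ∀ I : Finset (Fin n), 2 ≤ I.card →
      (I.filter fun i => p i < 1 - ∑ j ∈ Iᶜ, p j).Nonempty →
      2 ≤ ∑ i ∈ I.filter (fun i => p i < 1 - ∑ j ∈ Iᶜ, p j), (1 + ε) * xb i
        + 2 * ∑ i ∈ I \ I.filter (fun i => p i < 1 - ∑ j ∈ Iᶜ, p j), (1 + ε) * xb i)
    (yb : Fin n → ℝ) (hyb : ∀ i, yb i = min 1 ((1 + ε) / (1 - ε) * xb i)) :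
    -- then yb ∈ [0,1]^n and yb satisfies all of the above inequalities
    (∀ i, 0 ≤ yb i ∧ yb i ≤ 1) ∧
    (∀ T : Finset (Fin n), (∀ y ∈ MinKnapK n p, 1 ≤ ∑ i ∈ T, y i) →
      1 ≤ ∑ i ∈ T, yb i) ∧
    (∀ I : Finset (Fin n), 2 ≤ I.card →
      (I.filter fun i => p i < 1 - ∑ j ∈ Iᶜ, p j).Nonempty →
      2 ≤ ∑ i ∈ I.filter (fun i => p i < 1 - ∑ j ∈ Iᶜ, p j), yb i
        + 2 * ∑ i ∈ I \ I.filter (fun i => p i < 1 - ∑ j ∈ Iᶜ, p j), yb i) := by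
  have h1e : 0 < 1 - ε := by linarith
  have hy01 : ∀ i, 0 ≤ yb i ∧ yb i ≤ 1 := by
    intro i
    rw [hyb i]
    refine ⟨le_min zero_le_one (mul_nonneg (div_nonneg (by linarith) h1e.le) (hxb i).1),
      min_le_left _ _⟩
  have hyz : ∀ i, yb i ≠ 1 → (1 + ε) * xb i ≤ yb i := by
    intro i hi
    have h0 : 0 ≤ (1 + ε) * xb i := mul_nonneg (by linarith) (hxb i).1
    rw [hyb i] at hi ⊢
    rcases min_choice 1 ((1 + ε) / (1 - ε) * xb i) with h | h
    · exact absurd h hi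
    · rw [h, div_mul_eq_mul_div, le_div_iff₀ h1e]
      nlinarith
  have hpitch : ∀ T : Finset (Fin n), (∀ y ∈ MinKnapK n p, 1 ≤ ∑ i ∈ T, y i) →
      1 ≤ ∑ i ∈ T, yb i := by
    intro T hT
    by_cases h : ∃ i ∈ T, yb i = 1
    · obtain ⟨i, hi, h1⟩ := h
      rw [← h1]
      exact Finset.single_le_sum (fun j _ => (hy01 j).1) hi
    · push Not at h
      exact (hp1 T hT).trans (Finset.sum_le_sum fun i hi => hyz i (h i hi))
  refine ⟨hy01, hpitch, ?_⟩
  intro I hI hne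
  have key := hp2 I hI hne
  set I1 := I.filter (fun i => p i < 1 - ∑ j ∈ Iᶜ, p j) with hI1
  have hsub : I1 ⊆ I := Finset.filter_subset _ _
  have hs1 : 0 ≤ ∑ i ∈ I1, yb i := Finset.sum_nonneg fun j _ => (hy01 j).1
  have hs2 : 0 ≤ ∑ i ∈ I \ I1, yb i := Finset.sum_nonneg fun j _ => (hy01 j).1
  by_cases h2 : ∃ i ∈ I \ I1, yb i = 1
  · obtain ⟨i, hi, h1⟩ := h2
    have := Finset.single_le_sum (f := yb) (fun j _ => (hy01 j).1) hi
    linarith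
  by_cases h3 : ∃ i ∈ I1, yb i = 1
  · obtain ⟨i, hi, h1⟩ := h3
    have hiI := hsub hi
    have hpi : p i < 1 - ∑ j ∈ Iᶜ, p j := (Finset.mem_filter.mp hi).2
    have hv : 1 ≤ ∑ j ∈ I.erase i, yb j := by
      apply hpitch
      intro y hy
      obtain ⟨hy, hk⟩ := hy
      have hy0 : ∀ j, 0 ≤ y j := fun j => by rcases hy j with h | h <;> simp [h]
      have hy1 : ∀ j, y j ≤ 1 := fun j => by rcases hy j with h | h <;> simp [h]
      by_cases h : ∃ j ∈ I.erase i, y j = 1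
      · obtain ⟨j, hj, h1⟩ := h
        rw [← h1]
        exact Finset.single_le_sum (fun j _ => hy0 j) hj
      · push Not at h
        exfalso
        have e1 : ∑ j, p j * y j = ∑ j ∈ I, p j * y j + ∑ j ∈ Iᶜ, p j * y j :=
          (Finset.sum_add_sum_compl I _).symm
        have e2 := Finset.add_sum_erase I (fun j => p j * y j) hiI
        have e3 : ∑ j ∈ I.erase i, p j * y j = 0 :=
          Finset.sum_eq_zero fun j hj => by
            rw [(hy j).resolve_right (h j hj), mul_zero]
        have e4 : ∑ j ∈ Iᶜ, p j * y j ≤ ∑ j ∈ Iᶜ, p j :=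
          Finset.sum_le_sum fun j _ => mul_le_of_le_one_right (hp j).1 (hy1 j)
        have e5 : p i * y i ≤ p i := mul_le_of_le_one_right (hp i).1 (hy1 i)
        linarith
    have e1 := Finset.add_sum_erase I yb hiI
    have e2 := Finset.sum_sdiff (f := yb) hsub
    linarith
  · push Not at h2 h3
    have a1 := Finset.sum_le_sum fun i hi => hyz i (h3 i hi)
    have a2 := Finset.sum_le_sum fun i hi => hyz i (h2 i hi)
    linarith
end

section
/- Suppose the cost vector equals the profit vector (c = p) and K is nonempty. Let x* ∈ [0,1]^n be any point satisfying ∑_i p_i x*_i ≥ 1 together with every valid pitch-1 inequality and every valid pitch-2 inequality of K. Then min{∑_i p_i x_i : x ∈ K} ≤ (3/2)·∑_i p_i x*_i. In other words, the integrality gap of the linear relaxation of MinKnap strengthened by all pitch-1 and pitch-2 inequalities is at most 3/2 when c = p. -/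
open Finset

theorem aux_two_large {n : ℕ} (p : Fin n → ℝ) (hp : ∀ i, 0 ≤ p i ∧ p i ≤ 1)
    (H : ∀ F : Finset (Fin n), 1 ≤ ∑ i ∈ F, p i → 3/2 < ∑ i ∈ F, p i) :
    ∀ (m : ℕ) (F : Finset (Fin n)), F.card = m → 1 ≤ ∑ i ∈ F, p i →
      2 ≤ (F.filter (fun i => 1/2 < p i)).card := by
  intro m
  induction m with
  | zero =>
    intro F hF h1
    rw [Finset.card_eq_zero] at hF
    subst hF
    norm_num at h1
  | succ m ih =>
    intro F hF h1
    have h2 := H F h1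
    by_cases hs : ∃ i ∈ F, p i ≤ 1/2
    · obtain ⟨i, hi, hpi⟩ := hs
      have e := Finset.add_sum_erase F p hi
      have := ih (F.erase i) (by rw [Finset.card_erase_of_mem hi]; omega) (by linarith)
      exact this.trans (Finset.card_le_card
        (Finset.filter_subset_filter _ (Finset.erase_subset _ _)))
    · push Not at hs
      rw [Finset.filter_true_of_mem hs]
      have h3 : ∑ i ∈ F, p i ≤ ∑ i ∈ F, (1:ℝ) := Finset.sum_le_sum fun i _ => (hp i).2
      simp only [Finset.sum_const, nsmul_eq_mul, mul_one] at h3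
      have h4 : (1:ℝ) < F.card := by linarith
      exact_mod_cast h4

/-- With cost = profit (`c = p`), any point of the linear relaxation strengthened by all
valid pitch-1 and pitch-2 inequalities has cost at least `2/3` of the integer optimum. -/
theorem stmt_5 (n : ℕ) (p : Fin n → ℝ) (hp : ∀ i, 0 ≤ p i ∧ p i ≤ 1)
    (hK : (MinKnapK n p).Nonempty)
    (xs : Fin n → ℝ) (hxs : ∀ i, 0 ≤ xs i ∧ xs i ≤ 1)
    (hfrac : 1 ≤ ∑ i, p i * xs i)
    -- xs satisfies every valid pitch-1 and pitch-2 inequality of K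
    (hpitch : ∀ (T : Finset (Fin n)) (w : Fin n → ℝ) (β : ℝ),
      (∀ i ∈ T, 0 < w i) → 0 < β →
      (∀ y ∈ MinKnapK n p, β ≤ ∑ i ∈ T, w i * y i) →
      (pitch T w β = 1 ∨ pitch T w β = 2) →
      β ≤ ∑ i ∈ T, w i * xs i) :
    sInf {r : ℝ | ∃ x ∈ MinKnapK n p, r = ∑ i, p i * x i} ≤ 3/2 * ∑ i, p i * xs i := by
  by_contra hcon
  push Not at hcon
  set C := ∑ i, p i * xs i with hC
  have key : ∀ x ∈ MinKnapK n p, 3/2 * C < ∑ i, p i * x i := by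
    intro x hx
    refine lt_of_lt_of_le hcon (csInf_le ⟨0, ?_⟩ ⟨x, hx, rfl⟩)
    rintro r ⟨y, hy, rfl⟩
    linarith [hy.2]
  have keyF : ∀ F : Finset (Fin n), 1 ≤ ∑ i ∈ F, p i → 3/2 * C < ∑ i ∈ F, p i := by
    intro F hF
    have e : ∑ i, p i * (if i ∈ F then (1:ℝ) else 0) = ∑ i ∈ F, p i := by simp
    have := key (fun i => if i ∈ F then (1:ℝ) else 0)
      ⟨fun i => by by_cases h : i ∈ F <;> simp [h], by rw [e]; exact hF⟩
    rwa [e] at this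
  have two := fun F => aux_two_large p hp (fun F hF => by linarith [keyF F hF]) _ F rfl
  have hval : ∀ y ∈ MinKnapK n p,
      2 ≤ ((univ.filter (fun i => y i = 1)).filter (fun i => 1/2 < p i)).card := by
    intro y hy
    apply two
    refine hy.2.trans (le_of_eq ?_)
    rw [Finset.sum_filter]
    refine Finset.sum_congr rfl fun i _ => ?_
    rcases hy.1 i with h | h <;> simp [h]
  set L : Finset (Fin n) := univ.filter (fun i => 1/2 < p i) with hL
  have hLc : 2 ≤ L.card := by
    obtain ⟨y, hy⟩ := hK
    exact (hval y hy).trans (Finset.card_le_card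
      (Finset.filter_subset_filter _ (Finset.filter_subset _ _)))
  have hpit : pitch L (fun _ => (1:ℝ)) 2 = 2 := by
    unfold pitch
    apply le_antisymm
    · apply Nat.sInf_le
      intro S _ hS
      simp [hS]
    · apply le_csInf ⟨2, fun S _ hS => by simp [hS]⟩
      intro k hk
      by_contra hlt
      obtain ⟨S, hSL, hS⟩ := Finset.exists_subset_card_eq (s := L) (n := k) (by omega)
      have := hk S hSL hS
      simp only [Finset.sum_const, nsmul_eq_mul, mul_one, hS] at this
      exact hlt (by exact_mod_cast this)
  have h2 := hpitch L (fun _ => 1) 2 (fun _ _ => one_pos) two_pos (by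
    intro y hy
    have h := hval y hy
    have e : ∑ i ∈ L, (1:ℝ) * y i
        = ((univ.filter (fun i => y i = 1)).filter (fun i => 1/2 < p i)).card := by
      rw [Finset.filter_comm, Finset.card_filter]
      push_cast
      refine Finset.sum_congr rfl fun i _ => ?_
      rcases hy.1 i with h | h <;> simp [h]
    rw [e]
    exact_mod_cast h) (Or.inr hpit)
  simp only [one_mul] at h2
  obtain ⟨a, haL, hmin⟩ := Finset.exists_min_image L p (Finset.card_pos.mp (by omega))
  have hpair : ∀ j ∈ L.erase a, 3/2 * C - p a ≤ p j := by
    intro j hj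
    obtain ⟨hne, hjL⟩ := Finset.mem_erase.mp hj
    have h1 := (Finset.mem_filter.mp hjL).2
    have h3 := (Finset.mem_filter.mp haL).2
    have := keyF {a, j} (by rw [Finset.sum_pair hne.symm]; linarith)
    rw [Finset.sum_pair hne.symm] at this
    linarith
  have hCL : ∑ i ∈ L, p i * xs i ≤ C :=
    Finset.sum_le_sum_of_subset_of_nonneg (Finset.subset_univ _)
      fun i _ _ => mul_nonneg (hp i).1 (hxs i).1
  have e1 := Finset.add_sum_erase L (fun i => p i * xs i) haL
  have e2 := Finset.add_sum_erase L xs haL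
  have hA : (3/2 * C - p a) * ∑ i ∈ L.erase a, xs i ≤ ∑ i ∈ L.erase a, p i * xs i := by
    rw [Finset.mul_sum]
    exact Finset.sum_le_sum fun i hi => mul_le_mul_of_nonneg_right (hpair i hi) (hxs i).1
  have hB : p a * ∑ i ∈ L.erase a, xs i ≤ ∑ i ∈ L.erase a, p i * xs i := by
    rw [Finset.mul_sum]
    exact Finset.sum_le_sum fun i hi =>
      mul_le_mul_of_nonneg_right (hmin i (Finset.mem_of_mem_erase hi)) (hxs i).1
  have ha := hp a
  have hx := hxs a
  generalize ∑ i ∈ L.erase a, xs i = X at *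
  generalize ∑ i ∈ L.erase a, p i * xs i = Y at *
  have hX : 2 - xs a ≤ X := by linarith
  rcases le_total (2 * p a) (3/2 * C) with h | h
  · have t1 := mul_le_mul_of_nonneg_left hX (show 0 ≤ 3/2 * C - p a by linarith)
    have t2 := mul_nonneg (show 0 ≤ 3/2 * C - 2 * p a by linarith) (show 0 ≤ 1 - xs a by linarith)
    nlinarith
  · have t1 := mul_le_mul_of_nonneg_left hX ha.1
    nlinarith
end

section
/- Suppose 0 ≤ p_1 ≤ p_2 ≤ … ≤ p_n ≤ 1, and let i be an index such that the characteristic vector of {i, i+1} minimizes ∑_ℓ p_ℓ x_ℓ over K, p_i + p_{i+1} > 3/2, and p_ℓ < 1/4 for all ℓ < i. Then p_n + ∑_{ℓ=1}^{i−1} p_ℓ < 1. Consequently, the pitch-2 inequality ∑_{k=i}^n x_k ≥ 2 is valid for K. -/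
open Finset

theorem stmt_8 (n : ℕ) (p : Fin (n+1) → ℝ) (hp : ∀ i, 0 ≤ p i ∧ p i ≤ 1)
    (hmono : Monotone p)
    (i j : Fin (n+1)) (hj : (j : ℕ) = (i : ℕ) + 1)
    -- the characteristic vector of {i, i+1} minimizes ∑ ℓ, p ℓ * x ℓ over K
    (hmem : (fun ℓ => if ℓ = i ∨ ℓ = j then (1 : ℝ) else 0) ∈ MinKnapK (n+1) p)
    (hmin : ∀ y ∈ MinKnapK (n+1) p,
      ∑ ℓ, p ℓ * (if ℓ = i ∨ ℓ = j then (1 : ℝ) else 0) ≤ ∑ ℓ, p ℓ * y ℓ)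
    (hbig : 3/2 < p i + p j)
    (hsmall : ∀ ℓ, ℓ < i → p ℓ < 1/4) :
    -- p_n + ∑_{ℓ < i} p ℓ < 1
    p (Fin.last n) + ∑ ℓ ∈ univ.filter (fun ℓ => ℓ < i), p ℓ < 1 ∧
    -- consequently, the pitch-2 inequality ∑_{k=i}^{n} x k ≥ 2 is valid for K
    (∀ x ∈ MinKnapK (n+1) p, 2 ≤ ∑ k ∈ univ.filter (fun k => i ≤ k), x k) := by
  have hij : i ≠ j := by
    intro h
    rw [h] at hj
    omega
  have hval : ∑ ℓ, p ℓ * (if ℓ = i ∨ ℓ = j then (1 : ℝ) else 0) = p i + p j := by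
    have h1 : ∀ ℓ, p ℓ * (if ℓ = i ∨ ℓ = j then (1 : ℝ) else 0)
        = (if ℓ = i then p ℓ else 0) + (if ℓ = j then p ℓ else 0) := by
      intro ℓ
      by_cases h : ℓ = i
      · subst h; simp [hij]
      · simp [h]
    simp only [h1, Finset.sum_add_distrib, Finset.sum_ite_eq', Finset.mem_univ, if_true]
  rw [hval] at hmin
  have hset : ∀ T : Finset (Fin (n+1)), 1 ≤ ∑ ℓ ∈ T, p ℓ → 3/2 < ∑ ℓ ∈ T, p ℓ := by
    intro T hT
    have he : ∑ ℓ, p ℓ * (if ℓ ∈ T then (1:ℝ) else 0) = ∑ ℓ ∈ T, p ℓ := by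
      simp
    have := hmin (fun ℓ => if ℓ ∈ T then (1:ℝ) else 0)
      ⟨fun ℓ => by by_cases h : ℓ ∈ T <;> simp [h], by rw [he]; exact hT⟩
    rw [he] at this
    linarith
  have hlast : i < Fin.last n := by
    have := j.isLt
    rw [Fin.lt_def, Fin.val_last]
    omega
  have key : ∀ s : Finset (Fin (n+1)), (∀ ℓ ∈ s, ℓ < i) →
      p (Fin.last n) + ∑ ℓ ∈ s, p ℓ < 1 := by
    intro s
    induction s using Finset.induction_on with
    | empty =>
      intro _
      by_contra h
      have h1 := hset {Fin.last n} (by simpa using h)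
      have h2 := (hp (Fin.last n)).2
      simp only [Finset.sum_singleton] at h1
      linarith
    | insert a s ha ih =>
      intro hs
      have h0 := ih (fun ℓ hℓ => hs ℓ (Finset.mem_insert_of_mem hℓ))
      have h1 := hsmall a (hs a (Finset.mem_insert_self a s))
      have hnot : Fin.last n ∉ insert a s := fun h => lt_asymm (hs _ h) hlast
      by_contra h
      have h2 := hset (insert (Fin.last n) (insert a s)) (by
        rw [Finset.sum_insert hnot]; exact not_lt.mp h)
      rw [Finset.sum_insert hnot, Finset.sum_insert ha] at h2
      linarith
  have h1 := key (univ.filter (fun ℓ => ℓ < i)) (by simp)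
  refine ⟨h1, ?_⟩
  rintro x ⟨hx, hx1⟩
  have hcard : ∑ k ∈ univ.filter (fun k => i ≤ k), x k
      = (((univ.filter (fun k => i ≤ k)).filter (fun k => x k = 1)).card : ℝ) := by
    rw [Finset.card_filter, Nat.cast_sum]
    refine Finset.sum_congr rfl fun k _ => ?_
    rcases hx k with h | h <;> simp [h]
  by_contra hlt
  have hle : ∑ k ∈ univ.filter (fun k => i ≤ k), x k ≤ 1 := by
    rw [hcard] at hlt ⊢
    have : ((univ.filter (fun k => i ≤ k)).filter (fun k => x k = 1)).card < 2 := by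
      exact_mod_cast not_le.mp hlt
    exact_mod_cast Nat.le_of_lt_succ this
  have hx0 : ∀ k, 0 ≤ x k ∧ x k ≤ 1 := fun k => by
    rcases hx k with h | h <;> simp [h]
  have hA : ∑ k ∈ univ.filter (fun k => i ≤ k), p k * x k ≤ p (Fin.last n) := by
    calc _ ≤ ∑ k ∈ univ.filter (fun k => i ≤ k), p (Fin.last n) * x k :=
          Finset.sum_le_sum fun k _ =>
            mul_le_mul_of_nonneg_right (hmono (Fin.le_last k)) (hx0 k).1
      _ = p (Fin.last n) * ∑ k ∈ univ.filter (fun k => i ≤ k), x k := by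
          rw [Finset.mul_sum]
      _ ≤ p (Fin.last n) := mul_le_of_le_one_right (hp _).1 hle
  have hB : ∑ k ∈ univ.filter (fun k => k < i), p k * x k
      ≤ ∑ k ∈ univ.filter (fun k => k < i), p k :=
    Finset.sum_le_sum fun k _ => mul_le_of_le_one_right (hp k).1 (hx0 k).2
  have hsplit := Finset.sum_filter_add_sum_filter_not univ (fun k => k < i) (fun k => p k * x k)
  simp only [not_lt] at hsplit
  linarith
end

section
/- Assume K is nonempty, and let c ∈ ℝ^n with 0 < c_i ≤ 1 for all i. For t ∈ ℕ define K^t := {x ∈ [0,1]^n : ∑_i p_i x_i ≥ 1 and x satisfies every valid inequality for K of pitch at most t}. Then for every t ≥ 2: inf{∑_i c_i x_i : x ∈ K^{t−1}} ≥ max{1/2, (t−2)/(t−1)} · inf{∑_i c_i x_i : x ∈ K^t}. Equivalently, the integrality gap of K^t is at least max{1/2, (t−2)/(t−1)} times the integrality gap of K^{t−1}. -/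
open Finset

/-- `K^t`: the natural linear relaxation of MinKnap strengthened by all valid
inequalities of pitch at most `t`. -/
noncomputable def Kt (n : ℕ) (p : Fin n → ℝ) (t : ℕ) : Set (Fin n → ℝ) :=
  {x | (∀ i, 0 ≤ x i ∧ x i ≤ 1) ∧ 1 ≤ ∑ i, p i * x i ∧
    ∀ (T : Finset (Fin n)) (w : Fin n → ℝ) (β : ℝ),
      (∀ i ∈ T, 0 < w i) → 0 < β →
      (∀ y ∈ MinKnapK n p, β ≤ ∑ i ∈ T, w i * y i) →
      pitch T w β ≤ t →
      β ≤ ∑ i ∈ T, w i * x i}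

theorem aux_remove (n : ℕ) (p : Fin n → ℝ) (t : ℕ) (ht : 2 ≤ t) (x : Fin n → ℝ)
    (hx : x ∈ Kt n p (t - 1)) (T S : Finset (Fin n)) (w : Fin n → ℝ) (β : ℝ)
    (hw : ∀ i ∈ T, 0 < w i)
    (hv : ∀ y ∈ MinKnapK n p, β ≤ ∑ i ∈ T, w i * y i)
    (hpt : ∀ R ⊆ T, R.card = t → β ≤ ∑ i ∈ R, w i)
    (hS : S ⊆ T) (hne : S.Nonempty) :
    β - ∑ i ∈ S, w i ≤ ∑ i ∈ T \ S, w i * x i := by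
  obtain ⟨hx01, -, hx3⟩ := hx
  rcases le_or_gt (β - ∑ i ∈ S, w i) 0 with h0 | h0
  · refine h0.trans (Finset.sum_nonneg fun i hi => ?_)
    exact mul_nonneg (hw i (Finset.mem_sdiff.1 hi).1).le (hx01 i).1
  · refine hx3 (T \ S) w _ (fun i hi => hw i (Finset.mem_sdiff.1 hi).1) h0 ?_ ?_
    · intro y hy
      have h1 := hv y hy
      rw [← Finset.sum_sdiff hS] at h1
      have h2 : ∑ i ∈ S, w i * y i ≤ ∑ i ∈ S, w i := by
        refine Finset.sum_le_sum fun i hi => ?_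
        have := hw i (hS hi)
        rcases hy.1 i with h | h <;> rw [h] <;> linarith
      linarith
    · refine Nat.sInf_le ?_
      intro R hR hc
      obtain ⟨j, hj⟩ := hne
      have hjR : j ∉ R := fun h => (Finset.mem_sdiff.1 (hR h)).2 hj
      have hRT : R ⊆ T := fun i hi => (Finset.mem_sdiff.1 (hR hi)).1
      have h1 := hpt (insert j R) (Finset.insert_subset (hS hj) hRT)
        (by rw [Finset.card_insert_of_notMem hjR, hc]; omega)
      rw [Finset.sum_insert hjR] at h1
      have h2 : w j ≤ ∑ i ∈ S, w i :=
        Finset.single_le_sum (f := w) (fun i hi => (hw i (hS hi)).le) hj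
      linarith

theorem aux_scale (n : ℕ) (p : Fin n → ℝ) (t : ℕ) (ht : 2 ≤ t) (x : Fin n → ℝ)
    (hx : x ∈ Kt n p (t - 1)) (T : Finset (Fin n)) (w : Fin n → ℝ) (β : ℝ)
    (hw : ∀ i ∈ T, 0 < w i) (hβ : 0 < β)
    (hv : ∀ y ∈ MinKnapK n p, β ≤ ∑ i ∈ T, w i * y i)
    (hpt : ∀ R ⊆ T, R.card = t → β ≤ ∑ i ∈ R, w i)
    (hnp : t - 1 < pitch T w β) :
    max (1/2) (((t : ℝ) - 2) / ((t : ℝ) - 1)) * β ≤ ∑ i ∈ T, w i * x i := by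
  have hx0 : ∀ i, 0 ≤ x i := fun i => (hx.1 i).1
  have hone : ∀ j ∈ T, β - w j ≤ ∑ i ∈ T, w i * x i := by
    intro j hj
    have h := aux_remove n p t ht x hx T {j} w β hw hv hpt
      (Finset.singleton_subset_iff.2 hj) (Finset.singleton_nonempty j)
    rw [Finset.sum_singleton] at h
    refine h.trans (Finset.sum_le_sum_of_subset_of_nonneg Finset.sdiff_subset ?_)
    intro i hi _
    exact mul_nonneg (hw i hi).le (hx0 i)
  have hex : ∃ j ∈ T, ((t : ℝ) - 1) * w j ≤ β := by
    have h := Nat.notMem_of_lt_sInf hnp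
    simp only [Set.mem_setOf_eq, not_forall, not_le] at h
    obtain ⟨S, hST, hc, hlt⟩ := h
    by_contra hcon
    push Not at hcon
    have hcard : ((S.card : ℕ) : ℝ) = (t : ℝ) - 1 := by
      rw [hc, Nat.cast_sub (by omega)]; simp
    have ht1 : (0 : ℝ) < (t : ℝ) - 1 := by
      have : (2 : ℝ) ≤ t := by exact_mod_cast ht
      linarith
    have h2 : ∑ i ∈ S, β ≤ ∑ i ∈ S, ((t : ℝ) - 1) * w i :=
      Finset.sum_le_sum fun i hi => (hcon i (hST hi)).le
    rw [Finset.sum_const, nsmul_eq_mul, hcard, ← Finset.mul_sum] at h2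
    have := le_of_mul_le_mul_left h2 ht1
    linarith
  rcases Nat.lt_or_ge 2 t with h3 | h3
  · have h3' : (3 : ℝ) ≤ t := by exact_mod_cast h3
    have ht1 : (0 : ℝ) < (t : ℝ) - 1 := by linarith
    obtain ⟨j, hj, hjw⟩ := hex
    rw [max_eq_right (by rw [div_le_div_iff₀ (by norm_num) ht1]; linarith)]
    refine le_trans ?_ (hone j hj)
    rw [div_mul_eq_mul_div, div_le_iff₀ ht1]
    nlinarith
  · obtain rfl : t = 2 := by omega
    have hm : max (1/2 : ℝ) ((((2 : ℕ) : ℝ) - 2) / (((2 : ℕ) : ℝ) - 1)) = 1/2 := by norm_num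
    rw [hm]
    by_cases hs : ∃ j ∈ T, w j ≤ β / 2
    · obtain ⟨j, hj, hjw⟩ := hs
      have := hone j hj
      linarith
    · push Not at hs
      have h1 : (1 : ℝ) ≤ ∑ i ∈ T, (1 : ℝ) * x i := by
        refine hx.2.2 T (fun _ => 1) 1 (fun _ _ => one_pos) one_pos ?_ ?_
        · intro y hy
          have hpos := lt_of_lt_of_le hβ (hv y hy)
          obtain ⟨i, hi, hi0⟩ := Finset.exists_ne_zero_of_sum_ne_zero hpos.ne'
          have hyi : y i = 1 := (hy.1 i).resolve_left (fun h => hi0 (by rw [h, mul_zero]))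
          have := Finset.single_le_sum (f := fun i => (1 : ℝ) * y i) (s := T)
            (fun k _ => by rcases hy.1 k with h | h <;> simp [h]) hi
          simpa [hyi] using this
        · refine Nat.sInf_le ?_
          intro R _ hc
          simp [hc]
      have h2 : ∑ i ∈ T, β / 2 * x i ≤ ∑ i ∈ T, w i * x i :=
        Finset.sum_le_sum fun i hi => mul_le_mul_of_nonneg_right (hs i hi).le (hx0 i)
      rw [← Finset.mul_sum] at h2
      simp only [one_mul] at h1
      nlinarith

theorem aux_mem (n : ℕ) (p : Fin n → ℝ) (hp : ∀ i, 0 ≤ p i ∧ p i ≤ 1)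
    (t : ℕ) (ht : 2 ≤ t) (x : Fin n → ℝ) (hx : x ∈ Kt n p (t - 1)) (g : ℝ)
    (hg : g = max (1/2) (((t : ℝ) - 2) / ((t : ℝ) - 1))) (hg0 : 0 < g) (hg1 : g ≤ 1) :
    (fun i => min 1 (x i / g)) ∈ Kt n p t := by
  have hx0 : ∀ i, 0 ≤ x i := fun i => (hx.1 i).1
  have hle : ∀ i, x i ≤ min 1 (x i / g) := fun i =>
    le_min (hx.1 i).2 (le_div_self (hx0 i) hg0 hg1)
  refine ⟨fun i => ⟨(hx0 i).trans (hle i), min_le_left _ _⟩, ?_, ?_⟩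
  · exact hx.2.1.trans (Finset.sum_le_sum fun i _ =>
      mul_le_mul_of_nonneg_left (hle i) (hp i).1)
  intro T w β hw hβ hv hpi
  rcases Nat.lt_or_ge (t - 1) (pitch T w β) with hnp | hnp
  · have heq : pitch T w β = t := by omega
    have hpt : ∀ R ⊆ T, R.card = t → β ≤ ∑ i ∈ R, w i := by
      have hm : pitch T w β ∈ {k : ℕ | ∀ S ⊆ T, S.card = k → β ≤ ∑ i ∈ S, w i} :=
        Nat.sInf_mem (Nat.nonempty_of_pos_sInf (by
          change 0 < pitch T w β
          omega))
      rw [heq] at hm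
      exact hm
    by_cases hne : (T.filter (fun i => 1 ≤ x i / g)).Nonempty
    · have h := aux_remove n p t ht x hx T _ w β hw hv hpt (Finset.filter_subset _ _) hne
      rw [← Finset.sum_sdiff (Finset.filter_subset (fun i => 1 ≤ x i / g) T)]
      have h1 : ∑ i ∈ T.filter (fun i => 1 ≤ x i / g), w i * min 1 (x i / g)
          = ∑ i ∈ T.filter (fun i => 1 ≤ x i / g), w i :=
        Finset.sum_congr rfl fun i hi => by
          rw [min_eq_left (Finset.mem_filter.1 hi).2, mul_one]
      have h2 : ∑ i ∈ T \ T.filter (fun i => 1 ≤ x i / g), w i * x i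
          ≤ ∑ i ∈ T \ T.filter (fun i => 1 ≤ x i / g), w i * min 1 (x i / g) :=
        Finset.sum_le_sum fun i hi =>
          mul_le_mul_of_nonneg_left (hle i) (hw i (Finset.mem_sdiff.1 hi).1).le
      linarith
    · rw [Finset.not_nonempty_iff_eq_empty, Finset.filter_eq_empty_iff] at hne
      have h := aux_scale n p t ht x hx T w β hw hβ hv hpt hnp
      rw [← hg] at h
      have h1 : ∑ i ∈ T, w i * min 1 (x i / g) = (∑ i ∈ T, w i * x i) / g := by
        rw [Finset.sum_div]
        refine Finset.sum_congr rfl fun i hi => ?_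
        rw [min_eq_right (not_le.1 (hne hi)).le, mul_div_assoc]
      rw [h1, le_div_iff₀ hg0]
      linarith
  · exact (hx.2.2 T w β hw hβ hv hnp).trans (Finset.sum_le_sum fun i hi =>
      mul_le_mul_of_nonneg_left (hle i) (hw i hi).le)

theorem stmt_10 (n : ℕ) (p : Fin n → ℝ) (hp : ∀ i, 0 ≤ p i ∧ p i ≤ 1)
    (hK : (MinKnapK n p).Nonempty)
    (c : Fin n → ℝ) (hc : ∀ i, 0 < c i ∧ c i ≤ 1)
    (t : ℕ) (ht : 2 ≤ t) :
    max (1/2) (((t : ℝ) - 2) / ((t : ℝ) - 1)) *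
        sInf ((fun x => ∑ i, c i * x i) '' Kt n p t)
      ≤ sInf ((fun x => ∑ i, c i * x i) '' Kt n p (t - 1)) := by
  set g : ℝ := max (1/2) (((t : ℝ) - 2) / ((t : ℝ) - 1)) with hg
  have hg0 : 0 < g := lt_of_lt_of_le (by norm_num) (le_max_left _ _)
  have hg1 : g ≤ 1 := by
    have : (2 : ℝ) ≤ t := by exact_mod_cast ht
    refine max_le (by norm_num) ?_
    rw [div_le_one (by linarith)]
    linarith
  obtain ⟨y, hy⟩ := hK
  have hy' : y ∈ Kt n p (t - 1) := by
    refine ⟨fun i => ?_, hy.2, fun T w β _ _ hv _ => hv y hy⟩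
    rcases hy.1 i with h | h <;> rw [h] <;> norm_num
  refine le_csInf ⟨_, y, hy', rfl⟩ ?_
  rintro _ ⟨x, hx, rfl⟩
  have hmem := aux_mem n p hp t ht x hx g hg hg0 hg1
  have hb : BddBelow ((fun x => ∑ i, c i * x i) '' Kt n p t) := by
    refine ⟨0, ?_⟩
    rintro _ ⟨z, hz, rfl⟩
    exact Finset.sum_nonneg fun i _ => mul_nonneg (hc i).1.le (hz.1 i).1
  have h1 := csInf_le hb ⟨_, hmem, rfl⟩
  refine (mul_le_mul_of_nonneg_left h1 hg0.le).trans ?_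
  simp only [Finset.mul_sum]
  refine Finset.sum_le_sum fun i _ => ?_
  have h2 : g * min 1 (x i / g) ≤ x i := by
    calc g * min 1 (x i / g) ≤ g * (x i / g) :=
          mul_le_mul_of_nonneg_left (min_le_right _ _) hg0.le
      _ = x i := mul_div_cancel₀ _ hg0.ne'
  calc g * (c i * min 1 (x i / g)) = c i * (g * min 1 (x i / g)) := by ring
    _ ≤ c i * x i := mul_le_mul_of_nonneg_left h2 (hc i).1.le
end

section
/- Let n ≥ 4 be a perfect square and let F := {(y,z,x) ∈ {0,1} × {0,1} × {0,1}^n : (n−√n)y + (n/2)z + ∑_{i=1}^n x_i ≥ n}. Consider the fractional point (ȳ, z̄, x̄) with ȳ = 1, z̄ = 2/√n, and x̄_i = 1/(n−√n+1) for all i ∈ [n]. Then (ȳ, z̄, x̄) ∈ [0,1]^{n+2}, it satisfies (n−√n)ȳ + (n/2)z̄ + ∑_i x̄_i ≥ n, and it satisfies every valid pitch-1 inequality for F (in particular every inequality ∑_{v∈T} v ≥ 1 over a subset T of the variables {y,z,x_1,…,x_n} that is satisfied by all points of F). -/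
open Finset

/-- Coefficient vector of the covering constraint
`(n−√n) y + (n/2) z + ∑ x_i ≥ n`, where `n = m²` and the coordinates of
`Fin (n+2)` are ordered as `y, z, x_1, …, x_n`. -/
noncomputable def aVec (n m : ℕ) : Fin (n+2) → ℝ :=
  fun i => if (i : ℕ) = 0 then (n : ℝ) - m else if (i : ℕ) = 1 then (n : ℝ) / 2 else 1

/-- The covering set `F = {(y,z,x) ∈ {0,1}^{n+2} : (n−√n) y + (n/2) z + ∑ x_i ≥ n}`. -/
def Fcov (n m : ℕ) : Set (Fin (n+2) → ℝ) :=
  {v | (∀ i, v i = 0 ∨ v i = 1) ∧ (n : ℝ) ≤ ∑ i, aVec n m i * v i}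

/-- The fractional point `ȳ = 1`, `z̄ = 2/√n`, `x̄_i = 1/(n−√n+1)`. -/
noncomputable def vbar (n m : ℕ) : Fin (n+2) → ℝ :=
  fun i => if (i : ℕ) = 0 then 1 else if (i : ℕ) = 1 then 2 / (m : ℝ)
    else 1 / ((n : ℝ) - m + 1)

theorem vbar_nonneg_aux (n m : ℕ) (hnm : n = m * m) (hm : 2 ≤ m) (i : Fin (n+2)) :
    0 ≤ vbar n m i ∧ vbar n m i ≤ 1 := by
  have hm' : (2:ℝ) ≤ m := by exact_mod_cast hm
  have hn : (n:ℝ) = m * m := by exact_mod_cast hnm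
  have h1 : (1:ℝ) ≤ (n:ℝ) - m + 1 := by nlinarith
  unfold vbar
  split_ifs
  · norm_num
  · exact ⟨by positivity, by rw [div_le_one (by linarith)]; exact hm'⟩
  · exact ⟨by apply div_nonneg <;> linarith, by rw [div_le_one (by linarith)]; exact h1⟩

theorem core_aux (n m : ℕ) (hnm : n = m * m) (hm : 2 ≤ m) (T : Finset (Fin (n+2)))
    (h : ∑ i ∈ Tᶜ, aVec n m i < n) : 1 ≤ ∑ i ∈ T, vbar n m i := by
  have hm' : (2:ℝ) ≤ m := by exact_mod_cast hm
  have hn : (n:ℝ) = m * m := by exact_mod_cast hnm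
  have h1 : (1:ℝ) ≤ (n:ℝ) - m + 1 := by nlinarith
  have hv := fun i => vbar_nonneg_aux n m hnm hm i
  have ha : ∀ i, 0 ≤ aVec n m i := by
    intro i
    unfold aVec
    split_ifs
    · linarith
    · positivity
    · norm_num
  by_cases h0 : (0 : Fin (n+2)) ∈ T
  · have := Finset.single_le_sum (f := vbar n m) (fun i _ => (hv i).1) h0
    simpa [vbar] using this
  have h0' : (0 : Fin (n+2)) ∈ Tᶜ := by simpa using h0
  have a0 : aVec n m 0 = n - m := by simp [aVec]
  have a1 : aVec n m 1 = n / 2 := by simp [aVec]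
  rw [← Finset.add_sum_erase _ _ h0', a0] at h
  by_cases hz : (1 : Fin (n+2)) ∈ T
  · have hc : ∑ i ∈ Tᶜ.erase 0, aVec n m i = ((Tᶜ.erase 0).card : ℝ) := by
      rw [Finset.card_eq_sum_ones]
      push_cast
      apply Finset.sum_congr rfl
      intro i hi
      rw [Finset.mem_erase, Finset.mem_compl] at hi
      have e0 : (i : ℕ) ≠ 0 := fun e => hi.1 (Fin.ext (by simpa using e))
      have e1 : (i : ℕ) ≠ 1 := fun e => hi.2 (by
        have : i = 1 := Fin.ext (by simpa using e)
        rwa [this])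
      simp [aVec, e0, e1]
    rw [hc] at h
    have hlt : n + (Tᶜ.erase 0).card < n + m := by
      have : (n:ℝ) + ((Tᶜ.erase 0).card : ℝ) < n + m := by linarith
      exact_mod_cast this
    rw [Finset.card_erase_of_mem h0', Finset.card_compl, Fintype.card_fin] at hlt
    have hT : T.card ≤ n + 2 := by simpa using Finset.card_le_univ T
    have hE : n + 1 ≤ (T.erase 1).card + m := by
      rw [Finset.card_erase_of_mem hz]
      omega
    have hE' : (n:ℝ) + 1 ≤ ((T.erase 1).card : ℝ) + m := by exact_mod_cast hE
    have hs : ∑ i ∈ T.erase 1, vbar n m i = ((T.erase 1).card : ℝ) * (1 / ((n:ℝ) - m + 1)) := by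
      rw [← nsmul_eq_mul]
      apply Finset.sum_eq_card_nsmul
      intro i hi
      rw [Finset.mem_erase] at hi
      have e1 : (i : ℕ) ≠ 1 := fun e => hi.1 (Fin.ext (by simpa using e))
      have e0 : (i : ℕ) ≠ 0 := fun e => h0 (by
        have : i = 0 := Fin.ext (by simpa using e)
        rw [← this]; exact hi.2)
      simp [vbar, e0, e1]
    rw [← Finset.add_sum_erase _ _ hz, hs]
    have : 1 ≤ ((T.erase 1).card : ℝ) * (1 / ((n:ℝ) - m + 1)) := by
      rw [mul_one_div, le_div_iff₀ (by linarith)]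
      linarith
    linarith [(hv 1).1]
  · exfalso
    have hz' : (1 : Fin (n+2)) ∈ Tᶜ.erase 0 := by simp [hz]
    have := Finset.single_le_sum (f := aVec n m) (fun i _ => ha i) hz'
    rw [a1] at this
    nlinarith

theorem valid_aux (n m : ℕ) (T : Finset (Fin (n+2))) (w : Fin (n+2) → ℝ) (β : ℝ) (hβ : 0 < β)
    (h : ∀ u ∈ Fcov n m, β ≤ ∑ i ∈ T, w i * u i) : ∑ i ∈ Tᶜ, aVec n m i < n := by
  by_contra hc
  push Not at hc
  have := h (fun i => if i ∈ Tᶜ then 1 else 0) ⟨fun i => by by_cases hi : i ∈ Tᶜ <;> simp [hi], by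
    simpa only [mul_ite, mul_one, mul_zero, Finset.sum_ite_mem, Finset.univ_inter] using hc⟩
  have h2 : ∑ i ∈ T, w i * (if i ∈ Tᶜ then (1:ℝ) else 0) = 0 :=
    Finset.sum_eq_zero fun i hi => by simp [hi]
  linarith

theorem stmt_11 (n m : ℕ) (hnm : n = m * m) (hm : 2 ≤ m) :
    -- the fractional point lies in [0,1]^{n+2}
    (∀ i, 0 ≤ vbar n m i ∧ vbar n m i ≤ 1) ∧
    -- it satisfies the covering constraint
    (n : ℝ) ≤ ∑ i, aVec n m i * vbar n m i ∧
    -- it satisfies every valid pitch-1 inequality for F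
    (∀ (T : Finset (Fin (n+2))) (w : Fin (n+2) → ℝ) (β : ℝ),
      (∀ i ∈ T, 0 < w i) → 0 < β →
      (∀ u ∈ Fcov n m, β ≤ ∑ i ∈ T, w i * u i) →
      pitch T w β = 1 →
      β ≤ ∑ i ∈ T, w i * vbar n m i) ∧
    -- in particular, every inequality ∑_{v∈T} v ≥ 1 satisfied by all points of F
    (∀ T : Finset (Fin (n+2)), (∀ u ∈ Fcov n m, 1 ≤ ∑ i ∈ T, u i) →
      1 ≤ ∑ i ∈ T, vbar n m i) := by
  have hm' : (2:ℝ) ≤ m := by exact_mod_cast hm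
  have hn : (n:ℝ) = m * m := by exact_mod_cast hnm
  refine ⟨vbar_nonneg_aux n m hnm hm, ?_, ?_, ?_⟩
  · rw [Fin.sum_univ_succ, Fin.sum_univ_succ]
    have hr : 0 ≤ ∑ i : Fin n, aVec n m i.succ.succ * vbar n m i.succ.succ := by
      apply Finset.sum_nonneg
      intro i _
      apply mul_nonneg _ (vbar_nonneg_aux n m hnm hm _).1
      simp [aVec]
    have e0 : aVec n m 0 * vbar n m 0 = n - m := by simp [aVec, vbar]
    have e1 : aVec n m (Fin.succ 0) * vbar n m (Fin.succ 0) = m := by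
      simp only [aVec, vbar, Fin.val_succ, Fin.val_zero]
      norm_num
      rw [hn]
      field_simp
    rw [e0, e1]
    linarith
  · intro T w β hw hβ hval hp
    have hmem : 1 ∈ {k : ℕ | ∀ S ⊆ T, S.card = k → β ≤ ∑ i ∈ S, w i} := by
      rw [← hp]
      apply Nat.sInf_mem
      by_contra hne
      rw [Set.not_nonempty_iff_eq_empty] at hne
      rw [pitch, hne] at hp
      simp at hp
    have hb : ∀ i ∈ T, β ≤ w i := fun i hi => by
      simpa using hmem {i} (by simpa using hi) (by simp)
    have hc := core_aux n m hnm hm T (valid_aux n m T w β hβ hval)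
    calc β ≤ β * ∑ i ∈ T, vbar n m i := le_mul_of_one_le_right hβ.le hc
      _ = ∑ i ∈ T, β * vbar n m i := Finset.mul_sum _ _ _
      _ ≤ _ := Finset.sum_le_sum fun i hi =>
        mul_le_mul_of_nonneg_right (hb i hi) (vbar_nonneg_aux n m hnm hm i).1
  · intro T hval
    exact core_aux n m hnm hm T (valid_aux n m T (fun _ => 1) 1 one_pos (by simpa using hval))
end

section
/- Let n ≥ 4 be a perfect square, let 0 < ε < 1, and let F := {(y,z,x) ∈ {0,1} × {0,1} × {0,1}^n : (n−√n)y + (n/2)z + ∑_{i=1}^n x_i ≥ n}. Then min{εy + √n·z + ∑_{i=1}^n x_i : (y,z,x) ∈ F} = √n + ε. Consequently, since the fractional point (1, 2/√n, (1/(n−√n+1),…,1/(n−√n+1))) satisfies the linear constraint and all valid pitch-1 inequalities for F and has objective value ε + 2 + n/(n−√n+1), the integrality gap of the relaxation of F strengthened by all pitch-1 inequalities is at least (√n + ε)/(ε + 2 + n/(n−√n+1)), which is Ω(√n). -/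
open Finset

/-- The objective `ε y + √n z + ∑ x_i` (with `√n = m`). -/
noncomputable def objCov (n m : ℕ) (ε : ℝ) (v : Fin (n+2) → ℝ) : ℝ :=
  ε * v 0 + (m : ℝ) * v 1 + ∑ i ∈ univ.filter (fun i : Fin (n+2) => 2 ≤ (i : ℕ)), v i

/-- The natural relaxation of `F` strengthened by all valid pitch-1 inequalities. -/
noncomputable def P1cov (n m : ℕ) : Set (Fin (n+2) → ℝ) :=
  {v | (∀ i, 0 ≤ v i ∧ v i ≤ 1) ∧ (n : ℝ) ≤ ∑ i, aVec n m i * v i ∧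
    ∀ (T : Finset (Fin (n+2))) (w : Fin (n+2) → ℝ) (β : ℝ),
      (∀ i ∈ T, 0 < w i) → 0 < β →
      (∀ u ∈ Fcov n m, β ≤ ∑ i ∈ T, w i * u i) →
      pitch T w β = 1 →
      β ≤ ∑ i ∈ T, w i * v i}

lemma aux_filter (n : ℕ) (v : Fin (n+2) → ℝ) :
    ∑ i ∈ univ.filter (fun i : Fin (n+2) => 2 ≤ (i : ℕ)), v i = ∑ i : Fin n, v i.succ.succ := by
  rw [Finset.sum_filter, Fin.sum_univ_succ, Fin.sum_univ_succ]
  simp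

lemma aux_aVec (n m : ℕ) (v : Fin (n+2) → ℝ) :
    ∑ i, aVec n m i * v i
      = ((n:ℝ) - m) * v 0 + (n:ℝ)/2 * v 1 + ∑ i : Fin n, v i.succ.succ := by
  rw [Fin.sum_univ_succ, Fin.sum_univ_succ]
  simp [aVec, add_assoc]

lemma aux_obj (n m : ℕ) (ε : ℝ) (v : Fin (n+2) → ℝ) :
    objCov n m ε v = ε * v 0 + (m:ℝ) * v 1 + ∑ i : Fin n, v i.succ.succ := by
  rw [objCov, aux_filter]

lemma aux_mem_s12 (n m : ℕ) (hnm : n = m * m) (hm : 2 ≤ m) : vbar n m ∈ P1cov n m := by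
  have hmR : (2:ℝ) ≤ m := by exact_mod_cast hm
  have hnR : (n:ℝ) = m * m := by exact_mod_cast hnm
  have hd : (1:ℝ) ≤ (n:ℝ) - m + 1 := by nlinarith
  have hb : ∀ i, 0 ≤ vbar n m i ∧ vbar n m i ≤ 1 := by
    intro i
    unfold vbar
    split_ifs
    · norm_num
    · exact ⟨by positivity, by rw [div_le_one (by linarith)]; exact hmR⟩
    · exact ⟨by apply div_nonneg <;> linarith, by rw [div_le_one (by linarith)]; exact hd⟩
  refine ⟨hb, ?_, ?_⟩
  · rw [aux_aVec]
    have h1 : 0 ≤ ∑ i : Fin n, vbar n m i.succ.succ := Finset.sum_nonneg fun i _ => (hb _).1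
    have h2 : (n:ℝ)/2 * vbar n m 1 = m := by
      simp only [vbar, Fin.val_one]
      norm_num
      rw [hnR]
      have : (m:ℝ) ≠ 0 := by linarith
      field_simp
    have h3 : vbar n m 0 = 1 := by simp [vbar]
    rw [h2, h3]; linarith
  · intro T w β hw hβ hval hp
    have hS : ∀ i ∈ T, β ≤ w i := by
      have hne : {k : ℕ | ∀ S ⊆ T, S.card = k → β ≤ ∑ i ∈ S, w i}.Nonempty := by
        by_contra h
        rw [Set.not_nonempty_iff_eq_empty] at h
        rw [pitch, h] at hp
        simp at hp
      have h1 := Nat.sInf_mem hne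
      rw [pitch] at hp
      rw [hp] at h1
      intro i hi
      have := h1 {i} (by simpa using hi) (by simp)
      simpa using this
    have key : 1 ≤ ∑ i ∈ T, vbar n m i := by
      by_cases h0 : (0 : Fin (n+2)) ∈ T
      · have h3 : vbar n m 0 = 1 := by simp [vbar]
        rw [← h3]
        exact Finset.single_le_sum (f := vbar n m) (fun i _ => (hb i).1) h0
      · have hu : (fun i => if i ∈ T then (0:ℝ) else 1) ∉ Fcov n m := by
          intro hu
          have h := hval _ hu
          have h' : ∑ i ∈ T, w i * (if i ∈ T then (0:ℝ) else 1) = 0 :=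
            Finset.sum_eq_zero fun i hi => by simp [hi]
          linarith
        have hlt : ∑ i, aVec n m i * (if i ∈ T then (0:ℝ) else 1) < n := by
          by_contra h
          exact hu ⟨fun i => by by_cases hi : i ∈ T <;> simp [hi], not_lt.mp h⟩
        rw [aux_aVec n m (fun i => if i ∈ T then (0:ℝ) else 1)] at hlt
        have hz : 0 ≤ (n:ℝ)/2 * (if (1 : Fin (n+2)) ∈ T then (0:ℝ) else 1) := by
          split_ifs <;> positivity
        simp only [h0, if_false] at hlt
        have hc : ∑ i : Fin n, (if i.succ.succ ∈ T then (0:ℝ) else 1)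
            = n - ((univ.filter fun i : Fin n => i.succ.succ ∈ T).card : ℝ) := by
          have : ∀ i : Fin n, (if i.succ.succ ∈ T then (0:ℝ) else 1)
              = 1 - (if i.succ.succ ∈ T then (1:ℝ) else 0) := by
            intro i; split_ifs <;> simp
          rw [Finset.sum_congr rfl fun i _ => this i, Finset.sum_sub_distrib]
          simp
        rw [hc] at hlt
        set c := (univ.filter fun i : Fin n => i.succ.succ ∈ T).card with hcdef
        have hcc : n + 1 ≤ c + m := by
          have : (n:ℝ) < c + m := by linarith
          have : n < c + m := by exact_mod_cast this
          omega
        have hccR : (n:ℝ) + 1 ≤ c + m := by exact_mod_cast hcc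
        have hsum : (c:ℝ) * (1 / ((n:ℝ) - m + 1)) ≤ ∑ i ∈ T, vbar n m i := by
          have e : ∑ i ∈ T, vbar n m i = ∑ i, if i ∈ T then vbar n m i else 0 := by
            simp
          rw [e, Fin.sum_univ_succ, Fin.sum_univ_succ]
          have e2 : ∑ i : Fin n, (if i.succ.succ ∈ T then vbar n m i.succ.succ else 0)
              = (c:ℝ) * (1 / ((n:ℝ) - m + 1)) := by
            rw [← Finset.sum_filter]
            rw [Finset.sum_congr rfl (g := fun _ => 1 / ((n:ℝ) - m + 1))
              (fun i _ => by simp [vbar])]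
            rw [Finset.sum_const, nsmul_eq_mul]
          rw [e2]
          have p : ∀ i, 0 ≤ (if i ∈ T then vbar n m i else 0) := by
            intro i; split_ifs
            · exact (hb i).1
            · exact le_rfl
          have p0 := p 0
          have p1 := p (Fin.succ 0)
          linarith
        refine le_trans ?_ hsum
        rw [mul_one_div, le_div_iff₀ (by linarith)]
        linarith
    calc β = β * 1 := by ring
      _ ≤ β * ∑ i ∈ T, vbar n m i := mul_le_mul_of_nonneg_left key hβ.le
      _ = ∑ i ∈ T, β * vbar n m i := Finset.mul_sum ..
      _ ≤ _ := Finset.sum_le_sum fun i hi => mul_le_mul_of_nonneg_right (hS i hi) (hb i).1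

theorem stmt_12 (n m : ℕ) (hnm : n = m * m) (hm : 2 ≤ m)
    (ε : ℝ) (hε0 : 0 < ε) (hε1 : ε < 1) :
    -- the integer minimum equals √n + ε
    IsLeast {r : ℝ | ∃ v ∈ Fcov n m, r = objCov n m ε v} ((m : ℝ) + ε) ∧
    -- the fractional point belongs to the pitch-1-strengthened relaxation and has
    -- objective value ε + 2 + n/(n−√n+1)
    vbar n m ∈ P1cov n m ∧
    objCov n m ε (vbar n m) = ε + 2 + (n : ℝ) / ((n : ℝ) - m + 1) ∧
    -- hence the integrality gap of that relaxation is at least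
    -- (√n + ε)/(ε + 2 + n/(n−√n+1))
    ((m : ℝ) + ε) / (ε + 2 + (n : ℝ) / ((n : ℝ) - m + 1))
      ≤ ((m : ℝ) + ε) / sInf (objCov n m ε '' P1cov n m) := by
  have hmR : (2:ℝ) ≤ m := by exact_mod_cast hm
  have hnR : (n:ℝ) = m * m := by exact_mod_cast hnm
  have hmem := aux_mem_s12 n m hnm hm
  have hobj : objCov n m ε (vbar n m) = ε + 2 + (n : ℝ) / ((n : ℝ) - m + 1) := by
    have h0 : (m:ℝ) ≠ 0 := by linarith
    have h1 : (m:ℝ) * (2 / m) = 2 := by field_simp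
    rw [aux_obj]
    simp [vbar, h1, div_eq_mul_inv]
    field_simp
  refine ⟨⟨?_, ?_⟩, hmem, hobj, ?_⟩
  · refine ⟨fun i => if (i:ℕ) ≤ 1 then 1 else 0, ⟨?_, ?_⟩, ?_⟩
    · intro i; by_cases h : (i:ℕ) ≤ 1 <;> simp [h]
    · rw [aux_aVec]
      simp
      nlinarith
    · rw [aux_obj]
      simp
      ring
  · rintro r ⟨v, ⟨hv, hs⟩, rfl⟩
    rw [aux_aVec] at hs
    rw [aux_obj]
    have hx : 0 ≤ ∑ i : Fin n, v i.succ.succ :=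
      Finset.sum_nonneg fun i _ => by rcases hv i.succ.succ with h | h <;> rw [h] <;> norm_num
    rcases hv 0 with h0 | h0 <;> rcases hv 1 with h1 | h1 <;> rw [h0, h1] at hs ⊢ <;> nlinarith
  · rw [← hobj]
    have hlow : ∀ r ∈ objCov n m ε '' P1cov n m, 2 ≤ r := by
      rintro r ⟨v, ⟨hv, hs, -⟩, rfl⟩
      rw [aux_aVec] at hs
      rw [aux_obj]
      have hx : 0 ≤ ∑ i : Fin n, v i.succ.succ := Finset.sum_nonneg fun i _ => (hv _).1
      set X := ∑ i : Fin n, v i.succ.succ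
      have a0 := hv 0
      have a1 := hv 1
      have e0 : 0 ≤ ε * v 0 := mul_nonneg hε0.le a0.1
      have hy : ((n:ℝ) - m) * v 0 ≤ (n:ℝ) - m :=
        mul_le_of_le_one_right (by nlinarith) a0.2
      have h2 : (m:ℝ) ≤ (m:ℝ) * m / 2 * v 1 + X := by rw [← hnR]; linarith
      have h3 : (m:ℝ) * 2 ≤ m * (m * v 1 + X) := by nlinarith
      have := le_of_mul_le_mul_left h3 (by linarith)
      linarith
    have hpos : 0 < sInf (objCov n m ε '' P1cov n m) :=
      lt_of_lt_of_le two_pos (le_csInf ⟨_, _, hmem, rfl⟩ hlow)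
    exact div_le_div_of_nonneg_left (by linarith) hpos (csInf_le ⟨2, hlow⟩ ⟨_, hmem, rfl⟩)
end

section
/- Fix q ∈ ℕ and 0 < ε < 1. For a perfect square n ≥ 4, let P := {(y,z,x) ∈ [0,1] × [0,1] × [0,1]^n : (n−√n)y + (n/2)z + ∑_{i=1}^n x_i ≥ n} (a rational polyhedron with integer data), and let F := P ∩ {0,1}^{n+2}. Then there exists a constant C = C(q,ε) > 0, independent of n, such that for all perfect squares n ≥ 4: inf{εy + √n·z + ∑_i x_i : (y,z,x) ∈ P^{(q)}} ≤ C. Consequently, since min{εy + √n·z + ∑_i x_i over F} = √n + ε, the integrality gap of the q-th Chvátal–Gomory closure P^{(q)} is at least (√n + ε)/C = Ω(√n). -/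
open Finset

/-- The Chvátal–Gomory closure of a set `P ⊆ ℝ^ι`: all points satisfying every CG cut,
i.e. for every integral `c` and every `δ` with `c·u ≥ δ` valid on `P`, the cut
`c·v ≥ ⌈δ⌉`. For rational polyhedra this coincides with the closure defined via
nonnegative multipliers `λ` with `λᵀA` integral and right-hand sides `⌈λᵀb⌉`. -/
def cgClosure {ι : Type*} [Fintype ι] (P : Set (ι → ℝ)) : Set (ι → ℝ) :=
  {v | ∀ (c : ι → ℤ) (δ : ℝ), (∀ u ∈ P, δ ≤ ∑ j, (c j : ℝ) * u j) →
    (⌈δ⌉ : ℝ) ≤ ∑ j, (c j : ℝ) * v j}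

/-- The `q`-th Chvátal–Gomory closure. -/
def cgIter {ι : Type*} [Fintype ι] (P : Set (ι → ℝ)) : ℕ → Set (ι → ℝ)
  | 0 => P
  | q + 1 => cgClosure (cgIter P q)

/-- The polyhedron `P = {(y,z,x) ∈ [0,1]^{n+2} : (n−√n) y + (n/2) z + ∑ x_i ≥ n}`. -/
def Pcov (n m : ℕ) : Set (Fin (n+2) → ℝ) :=
  {v | (∀ i, 0 ≤ v i ∧ v i ≤ 1) ∧ (n : ℝ) ≤ ∑ i, aVec n m i * v i}

def XS (n : ℕ) : Finset (Fin (n+2)) := univ.filter (fun i : Fin (n+2) => 2 ≤ (i : ℕ))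

lemma mem_XS {n : ℕ} (i : Fin (n+2)) : i ∈ XS n ↔ 2 ≤ (i : ℕ) := by simp [XS]

lemma tri {n : ℕ} (i : Fin (n+2)) : i = 0 ∨ i = 1 ∨ (i ≠ 0 ∧ i ≠ 1 ∧ 2 ≤ (i : ℕ)) := by
  by_cases h0 : i = 0
  · exact Or.inl h0
  by_cases h1 : i = 1
  · exact Or.inr (Or.inl h1)
  refine Or.inr (Or.inr ⟨h0, h1, ?_⟩)
  have a0 : (i : ℕ) ≠ 0 := fun h => h0 (Fin.ext (by simpa using h))
  have a1 : (i : ℕ) ≠ 1 := fun h => h1 (Fin.ext (by simpa using h))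
  omega

lemma ne_of_two {n : ℕ} (i : Fin (n+2)) (h : 2 ≤ (i : ℕ)) : i ≠ 0 ∧ i ≠ 1 := by
  constructor
  · rintro rfl; simp at h
  · rintro rfl; simp at h

lemma XS_compl (n : ℕ) : (univ : Finset (Fin (n+2))) = insert 0 (insert 1 (XS n)) := by
  ext i
  simp only [mem_univ, mem_insert, mem_XS, true_iff]
  rcases tri i with h | h | h
  · exact Or.inl h
  · exact Or.inr (Or.inl h)
  · exact Or.inr (Or.inr h.2.2)

lemma sum_split {n : ℕ} (f : Fin (n+2) → ℝ) :
    ∑ i, f i = f 0 + (f 1 + ∑ i ∈ XS n, f i) := by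
  rw [XS_compl, sum_insert, sum_insert]
  · simp [mem_XS]
  · simp [mem_XS]

lemma card_XS (n : ℕ) : (XS n).card = n := by
  have h := congrArg Finset.card (XS_compl n)
  rw [card_insert_of_notMem, card_insert_of_notMem] at h
  · simp at h; omega
  · simp [mem_XS]
  · simp [mem_XS]

lemma aVec_dot {n m : ℕ} (v : Fin (n+2) → ℝ) :
    ∑ i, aVec n m i * v i = ((n : ℝ) - m) * v 0 + (n / 2 * v 1 + ∑ i ∈ XS n, v i) := by
  rw [sum_split]
  congr 1
  congr 1
  apply sum_congr rfl
  intro i hi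
  rw [mem_XS] at hi
  have h0 : (i : ℕ) ≠ 0 := by omega
  have h1 : (i : ℕ) ≠ 1 := by omega
  simp [aVec, h0, h1]

lemma cg_int {ι : Type*} [Fintype ι] {P : Set (ι → ℝ)} (c : ι → ℤ) (d : ℤ)
    (h : ∀ u ∈ P, (d : ℝ) ≤ ∑ j, (c j : ℝ) * u j) :
    ∀ u ∈ cgClosure P, (d : ℝ) ≤ ∑ j, (c j : ℝ) * u j := by
  intro u hu
  have := hu c d h
  simpa using this

def aInt (n m : ℕ) : Fin (n+2) → ℤ :=
  fun i => if (i : ℕ) = 0 then 2 * ((n : ℤ) - m) else if (i : ℕ) = 1 then (n : ℤ) else 2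

lemma aInt_eq (n m : ℕ) (i : Fin (n+2)) : ((aInt n m i : ℤ) : ℝ) = 2 * aVec n m i := by
  unfold aInt aVec
  split_ifs
  · push_cast; ring
  · push_cast; ring
  · push_cast; ring

lemma aInt_dot (n m : ℕ) (v : Fin (n+2) → ℝ) :
    ∑ i, ((aInt n m i : ℤ) : ℝ) * v i = 2 * ∑ i, aVec n m i * v i := by
  rw [mul_sum]
  apply sum_congr rfl
  intro i _
  rw [aInt_eq]; ring

lemma single_dot {n : ℕ} (i : Fin (n+2)) (s : ℤ) (v : Fin (n+2) → ℝ) :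
    ∑ j, (((Pi.single i s : Fin (n+2) → ℤ) j : ℤ) : ℝ) * v j = s * v i := by
  rw [Finset.sum_eq_single i]
  · simp
  · intro j _ hj
    simp [Pi.single_eq_of_ne hj]
  · simp

lemma cg_sub (n m : ℕ) (P : Set (Fin (n+2) → ℝ)) (hP : P ⊆ Pcov n m) :
    cgClosure P ⊆ Pcov n m := by
  intro v hv
  refine ⟨fun i => ⟨?_, ?_⟩, ?_⟩
  · have := cg_int (Pi.single i 1) 0 (P := P) (by
      intro u hu
      rw [single_dot]
      have := ((hP hu).1 i).1
      simpa using this) v hv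
    rw [single_dot] at this
    simpa using this
  · have := cg_int (Pi.single i (-1)) (-1) (P := P) (by
      intro u hu
      rw [single_dot]
      have := ((hP hu).1 i).2
      push_cast; linarith) v hv
    rw [single_dot] at this
    push_cast at this; linarith
  · have := cg_int (aInt n m) (2 * n) (P := P) (by
      intro u hu
      rw [aInt_dot]
      have := (hP hu).2
      push_cast; linarith) v hv
    rw [aInt_dot] at this
    push_cast at this; linarith

lemma iter_sub (n m q : ℕ) : cgIter (Pcov n m) q ⊆ Pcov n m := by
  induction q with
  | zero => exact subset_rfl
  | succ q ih => exact cg_sub n m _ ih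

def Jset (n m : ℕ) : Set (Fin (n+2) → ℝ) :=
  {v | (∀ i, v i = 0 ∨ v i = 1) ∧ v 0 = 1 ∧ (v 1 = 1 ∨ (m : ℝ) ≤ ∑ i ∈ XS n, v i)}

def Qset (n m k : ℕ) : Set (Fin (n+2) → ℝ) :=
  {v | v 0 = 1 ∧ 2 / (m : ℝ) ≤ v 1 ∧ v 1 ≤ 1 ∧
    ∀ i : Fin (n+2), 2 ≤ (i : ℕ) → 2 * (k : ℝ) / n ≤ v i ∧ v i ≤ 1}

lemma ceil_le_int {n : ℕ} (c : Fin (n+2) → ℤ) (δ : ℝ) (u : Fin (n+2) → ℝ)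
    (hu : ∀ i, u i = 0 ∨ u i = 1) (h : δ ≤ ∑ j, (c j : ℝ) * u j) :
    (⌈δ⌉ : ℝ) ≤ ∑ j, (c j : ℝ) * u j := by
  have : ∑ j, (c j : ℝ) * u j = ((∑ j, if u j = 1 then c j else 0 : ℤ) : ℝ) := by
    push_cast
    apply sum_congr rfl
    intro i _
    rcases hu i with h | h <;> simp [h]
  rw [this] at h ⊢
  exact_mod_cast Int.ceil_le.mpr h

lemma J_step (n m : ℕ) (P : Set (Fin (n+2) → ℝ)) (hJ : Jset n m ⊆ P) :
    Jset n m ⊆ cgClosure P := by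
  intro v hv c δ h
  exact ceil_le_int c δ v hv.1 (h v (hJ hv))

lemma Q_step (n m k : ℕ) (hn : n = m * m) (hm : 2 ≤ m) (P : Set (Fin (n+2) → ℝ))
    (hJ : Jset n m ⊆ P) (hQ : Qset n m k ⊆ P) :
    Qset n m (k+1) ⊆ cgClosure P := by
  rintro v ⟨hv0, hv1, hv1', hvx⟩ c δ h
  have hmpos : (0 : ℝ) < m := by positivity
  have hnpos : (0 : ℝ) < n := by subst hn; push_cast; positivity
  have hv1nn : 0 ≤ v 1 := le_trans (by positivity) hv1
  have hvnn : ∀ i : Fin (n+2), 2 ≤ (i : ℕ) → 0 ≤ v i := fun i hi =>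
    le_trans (by positivity) (hvx i hi).1
  -- integer comparison
  have key : ∀ b : ℝ, (b = 0 ∨ b = 1) → (c 1 : ℝ) * b ≤ c 1 * v 1 →
      (b = 1 ∨ m ≤ ((XS n).filter (fun i => c i ≤ 0)).card) →
      (⌈δ⌉ : ℝ) ≤ ∑ j, (c j : ℝ) * v j := by
    intro b hb hb1 hbm
    let u : Fin (n+2) → ℝ := fun i =>
      if i = 0 then 1 else if i = 1 then b else if c i ≤ 0 then 1 else 0
    have hu : ∀ i, u i = 0 ∨ u i = 1 := by
      intro i
      simp only [u]
      split_ifs <;> simp [hb]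
    have huJ : u ∈ Jset n m := by
      refine ⟨hu, by simp [u], ?_⟩
      rcases hbm with hbm | hbm
      · left; simp [u, hbm]
      · right
        have : ∑ i ∈ XS n, u i = ∑ i ∈ XS n, if c i ≤ 0 then (1 : ℝ) else 0 := by
          apply sum_congr rfl
          intro i hi
          have := ne_of_two i ((mem_XS i).1 hi)
          simp [u, this]
        rw [this, sum_boole]
        exact_mod_cast hbm
    refine (ceil_le_int c δ u hu (h u (hJ huJ))).trans ?_
    apply sum_le_sum
    intro i _
    rcases tri i with hi | hi | ⟨h0, h1, h2⟩
    · subst hi; simp [u, hv0]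
    · subst hi; simpa [u] using hb1
    · by_cases hc : c i ≤ 0
      · have hc' : (c i : ℝ) ≤ 0 := by exact_mod_cast hc
        simp only [u, h0, h1, hc, if_true, if_false]
        exact mul_le_mul_of_nonpos_left (hvx i h2).2 hc'
      · have hc' : (0 : ℝ) ≤ c i := by exact_mod_cast (not_le.1 hc).le
        simp only [u, h0, h1, hc, if_false, mul_zero]
        exact mul_nonneg hc' (hvnn i h2)
  by_cases ha : c 1 < 0
  · have ha' : (c 1 : ℝ) ≤ 0 := by exact_mod_cast ha.le
    exact key 1 (Or.inr rfl) (mul_le_mul_of_nonpos_left hv1' ha') (Or.inl rfl)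
  have ha' : (0 : ℝ) ≤ c 1 := by exact_mod_cast not_lt.1 ha
  by_cases hN : m ≤ ((XS n).filter (fun i => c i ≤ 0)).card
  · exact key 0 (Or.inl rfl) (by rw [mul_zero]; exact mul_nonneg ha' hv1nn) (Or.inr hN)
  have hcard := Finset.card_filter_add_card_filter_not (s := XS n) (fun i => c i ≤ 0)
  rw [card_XS] at hcard
  set p := ((XS n).filter (fun i => ¬ c i ≤ 0)).card with hp
  have hp2 : n ≤ 2 * p := by
    have : n + 1 ≤ p + m := by omega
    nlinarith
  let u : Fin (n+2) → ℝ := fun i =>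
    if i = 0 then 1 else if i = 1 then v 1 else if c i ≤ 0 then 1 else v i - 2 / n
  have huQ : u ∈ Qset n m k := by
    refine ⟨by simp [u], by simpa [u] using hv1, by simpa [u] using hv1', ?_⟩
    intro i hi
    obtain ⟨h0, h1⟩ := ne_of_two i hi
    obtain ⟨hl, hr⟩ := hvx i hi
    have e : 2 * ((k + 1 : ℕ) : ℝ) / n = 2 * (k : ℝ) / n + 2 / n := by push_cast; ring
    have e2 : 0 < 2 / (n : ℝ) := by positivity
    rw [e] at hl
    simp only [u, h0, h1, if_false]
    split_ifs
    · constructor <;> linarith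
    · constructor <;> linarith
  have hδ := h u (hQ huQ)
  have hle : ∑ j, ((c j : ℝ) * u j) + ∑ j ∈ XS n, (if ¬ c j ≤ 0 then 2 / (n : ℝ) else 0)
      ≤ ∑ j, (c j : ℝ) * v j := by
    rw [sum_split, sum_split (fun j => (c j : ℝ) * v j)]
    have hx : ∑ j ∈ XS n, ((c j : ℝ) * u j) + ∑ j ∈ XS n, (if ¬ c j ≤ 0 then 2 / (n : ℝ) else 0)
        ≤ ∑ j ∈ XS n, (c j : ℝ) * v j := by
      rw [← sum_add_distrib]
      apply sum_le_sum
      intro i hi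
      rw [mem_XS] at hi
      obtain ⟨h0, h1⟩ := ne_of_two i hi
      by_cases hc : c i ≤ 0
      · have hc' : (c i : ℝ) ≤ 0 := by exact_mod_cast hc
        simp only [u, h0, h1, hc, if_true, if_false, not_true, add_zero]
        exact mul_le_mul_of_nonpos_left (hvx i hi).2 hc'
      · have hc' : (1 : ℝ) ≤ c i := by exact_mod_cast (not_le.1 hc)
        have e2 : 0 < 2 / (n : ℝ) := by positivity
        simp only [u, h0, h1, hc, if_false, not_false_eq_true, if_true]
        nlinarith
    have u0 : u 0 = v 0 := by simp [u, hv0]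
    have u1 : u 1 = v 1 := by simp [u]
    rw [u0, u1]
    linarith
  have hone : (1 : ℝ) ≤ ∑ j ∈ XS n, (if ¬ c j ≤ 0 then 2 / (n : ℝ) else 0) := by
    rw [← sum_filter, sum_const, ← hp, nsmul_eq_mul, mul_div_assoc', le_div_iff₀ hnpos]
    have : (n : ℝ) ≤ 2 * p := by exact_mod_cast hp2
    linarith
  have := Int.ceil_lt_add_one δ
  linarith

lemma iter_sup (n m q : ℕ) (hn : n = m * m) (hm : 2 ≤ m) :
    Jset n m ⊆ cgIter (Pcov n m) q ∧ Qset n m q ⊆ cgIter (Pcov n m) q := by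
  have hm' : (2 : ℝ) ≤ m := by exact_mod_cast hm
  have hn' : (n : ℝ) = m * m := by exact_mod_cast hn
  induction q with
  | zero =>
    constructor
    · rintro v ⟨hv, h0, h1⟩
      have hb : ∀ i, 0 ≤ v i ∧ v i ≤ 1 := by
        intro i
        rcases hv i with h | h <;> rw [h] <;> norm_num
      refine ⟨hb, ?_⟩
      rw [aVec_dot, h0]
      have hs : 0 ≤ ∑ i ∈ XS n, v i := sum_nonneg fun i _ => (hb i).1
      rcases h1 with h1 | h1
      · rw [h1]; nlinarith
      · have : 0 ≤ (n : ℝ) / 2 * v 1 := mul_nonneg (by positivity) (hb 1).1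
        linarith
    · rintro v ⟨h0, h1, h1', hx⟩
      have hx0 : ∀ i : Fin (n+2), 2 ≤ (i : ℕ) → 0 ≤ v i := fun i hi => by
        simpa using (hx i hi).1
      have h1p : 0 ≤ v 1 := le_trans (by positivity) h1
      refine ⟨?_, ?_⟩
      · intro i
        rcases tri i with hi | hi | ⟨_, _, h2⟩
        · subst hi; rw [h0]; norm_num
        · subst hi; exact ⟨h1p, h1'⟩
        · exact ⟨hx0 i h2, (hx i h2).2⟩
      · rw [aVec_dot, h0]
        have hs : 0 ≤ ∑ i ∈ XS n, v i := sum_nonneg fun i hi => hx0 i ((mem_XS i).1 hi)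
        rw [div_le_iff₀ (by linarith)] at h1
        have : (n : ℝ) / 2 * v 1 = m / 2 * (v 1 * m) := by rw [hn']; ring
        nlinarith
  | succ q ih =>
    exact ⟨J_step n m _ ih.1, Q_step n m q hn hm _ ih.1 ih.2⟩

lemma obj_eq (n m : ℕ) (ε : ℝ) (v : Fin (n+2) → ℝ) :
    objCov n m ε v = ε * v 0 + m * v 1 + ∑ i ∈ XS n, v i := rfl

lemma obj_lower (n m : ℕ) (ε : ℝ) (hε0 : 0 < ε) (hn : n = m * m) (hm : 2 ≤ m)
    (v : Fin (n+2) → ℝ) (hv : v ∈ Pcov n m) : 2 ≤ objCov n m ε v := by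
  have hm' : (2 : ℝ) ≤ m := by exact_mod_cast hm
  have hn' : (n : ℝ) = m * m := by exact_mod_cast hn
  obtain ⟨hb, hc⟩ := hv
  rw [aVec_dot, hn'] at hc
  rw [obj_eq]
  have hs : 0 ≤ ∑ i ∈ XS n, v i := sum_nonneg fun i _ => (hb i).1
  set s := ∑ i ∈ XS n, v i
  have h0 := hb 0
  have h1 := hb 1
  have hy : ((m : ℝ) * m - m) * v 0 ≤ (m * m - m) * 1 :=
    mul_le_mul_of_nonneg_left h0.2 (by nlinarith)
  have hsm : s ≤ m / 2 * s := by nlinarith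
  have h3 : (m : ℝ) / 2 * 2 ≤ m / 2 * (m * v 1 + s) := by nlinarith
  have h4 : (2 : ℝ) ≤ m * v 1 + s := le_of_mul_le_mul_left h3 (by linarith)
  have : 0 ≤ ε * v 0 := mul_nonneg hε0.le h0.1
  linarith

def ptv (n : ℕ) (b t : ℝ) : Fin (n+2) → ℝ := fun i =>
  if i = 0 then 1 else if i = 1 then b else t

lemma ptv_obj (n m : ℕ) (ε b t : ℝ) : objCov n m ε (ptv n b t) = ε + m * b + n * t := by
  have : ∑ i ∈ XS n, ptv n b t i = n * t := by
    rw [sum_congr rfl (g := fun _ => t), sum_const, card_XS, nsmul_eq_mul]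
    intro i hi
    have := ne_of_two i ((mem_XS i).1 hi)
    simp [ptv, this]
  rw [obj_eq, this]
  simp [ptv]

lemma ptv_J (n m : ℕ) : ptv n 1 0 ∈ Jset n m := by
  refine ⟨?_, by simp [ptv], Or.inl (by simp [ptv])⟩
  intro i
  simp only [ptv]
  split_ifs <;> simp

lemma least (n m : ℕ) (ε : ℝ) (hε0 : 0 < ε) (hε1 : ε < 1) (hn : n = m * m) (hm : 2 ≤ m) :
    IsLeast {r : ℝ | ∃ v ∈ Fcov n m, r = objCov n m ε v} ((m : ℝ) + ε) := by
  have hm' : (2 : ℝ) ≤ m := by exact_mod_cast hm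
  have hn' : (n : ℝ) = m * m := by exact_mod_cast hn
  constructor
  · have hJ := ptv_J n m
    refine ⟨ptv n 1 0, ⟨hJ.1, ((iter_sup n m 0 hn hm).1 hJ).2⟩, ?_⟩
    rw [ptv_obj]; ring
  · rintro r ⟨v, ⟨hv, hc⟩, rfl⟩
    rw [aVec_dot, hn'] at hc
    rw [obj_eq]
    have hs : 0 ≤ ∑ i ∈ XS n, v i := sum_nonneg fun i _ => by
      rcases hv i with h | h <;> rw [h] <;> norm_num
    rcases hv 0 with h0 | h0 <;> rcases hv 1 with h1 | h1 <;> rw [h0, h1] at hc ⊢ <;> nlinarith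

theorem stmt_13 (q : ℕ) (ε : ℝ) (hε0 : 0 < ε) (hε1 : ε < 1) :
    ∃ C : ℝ, 0 < C ∧ ∀ n m : ℕ, n = m * m → 2 ≤ m →
      -- the infimum of the objective over the q-th CG closure is at most C
      sInf (objCov n m ε '' cgIter (Pcov n m) q) ≤ C ∧
      -- while the integer minimum equals √n + ε
      IsLeast {r : ℝ | ∃ v ∈ Fcov n m, r = objCov n m ε v} ((m : ℝ) + ε) ∧
      -- hence the integrality gap of the q-th CG closure is at least (√n + ε)/C
      ((m : ℝ) + ε) / C ≤ ((m : ℝ) + ε) / sInf (objCov n m ε '' cgIter (Pcov n m) q) := by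
  refine ⟨2 * q + 3, by positivity, ?_⟩
  intro n m hn hm
  have hm' : (2 : ℝ) ≤ m := by exact_mod_cast hm
  have hn' : (n : ℝ) = m * m := by exact_mod_cast hn
  have hnpos : (0 : ℝ) < n := by rw [hn']; positivity
  obtain ⟨hJ, hQ⟩ := iter_sup n m q hn hm
  have hlow : ∀ r ∈ objCov n m ε '' cgIter (Pcov n m) q, 2 ≤ r := by
    rintro r ⟨v, hv, rfl⟩
    exact obj_lower n m ε hε0 hn hm v (iter_sub n m q hv)
  have hbdd : BddBelow (objCov n m ε '' cgIter (Pcov n m) q) := ⟨2, hlow⟩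
  have hne : (objCov n m ε '' cgIter (Pcov n m) q).Nonempty :=
    ⟨_, ptv n 1 0, hJ (ptv_J n m), rfl⟩
  have h2 : 2 ≤ sInf (objCov n m ε '' cgIter (Pcov n m) q) := le_csInf hne hlow
  have hC : sInf (objCov n m ε '' cgIter (Pcov n m) q) ≤ 2 * q + 3 := by
    by_cases hq : (2 * (q : ℝ)) ≤ n
    · have hmem : ptv n (2 / m) (2 * q / n) ∈ Qset n m q := by
        refine ⟨by simp [ptv], by simp [ptv], ?_, ?_⟩
        · have : (2 : ℝ) / m ≤ 1 := by rw [div_le_one (by linarith)]; exact hm'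
          simpa [ptv] using this
        · intro i hi
          have := ne_of_two i hi
          have h1 : 2 * (q : ℝ) / n ≤ 1 := by rw [div_le_one hnpos]; exact hq
          simpa [ptv, this] using h1
      refine (csInf_le hbdd ⟨_, hQ hmem, rfl⟩).trans ?_
      rw [ptv_obj, mul_div_cancel₀ _ (by linarith), mul_div_cancel₀ _ hnpos.ne']
      linarith
    · refine (csInf_le hbdd ⟨_, hJ (ptv_J n m), rfl⟩).trans ?_
      rw [ptv_obj]
      push Not at hq
      nlinarith
  refine ⟨hC, least n m ε hε0 hε1 hn hm, ?_⟩
  exact div_le_div_of_nonneg_left (by linarith) (by linarith) hC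
end

section
/- Let p ∈ ℝ^n with p ≥ 0, let b > 0, and let c ∈ ℝ^n with c ≥ 0. Suppose x̄ ∈ [0,1]^n satisfies every knapsack cover inequality: for each S ⊆ [n] with β_S := b − ∑_{i∈S} p_i > 0, ∑_{i∈[n]∖S} min{p_i, β_S} x̄_i ≥ β_S. Then there exists x ∈ {0,1}^n with ∑_i p_i x_i ≥ b and ∑_i c_i x_i ≤ 2·∑_i c_i x̄_i. In particular, the linear relaxation given by all knapsack cover inequalities has integrality gap at most 2. -/
open Finset

lemma kc_aux (n : ℕ) (p : Fin n → ℝ) (hp : ∀ i, 0 ≤ p i) (b : ℝ)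
    (xb : Fin n → ℝ) (hxb : ∀ i, 0 ≤ xb i ∧ xb i ≤ 1)
    (hKC : ∀ S : Finset (Fin n), 0 < b - ∑ i ∈ S, p i →
      b - ∑ i ∈ S, p i ≤ ∑ i ∈ Sᶜ, min (p i) (b - ∑ j ∈ S, p j) * xb i) :
    ∀ (k : ℕ) (S : Finset (Fin n)) (c : Fin n → ℝ), Sᶜ.card = k →
      0 < b - ∑ i ∈ S, p i → (∀ i ∈ Sᶜ, 0 ≤ c i) →
      ∃ (T : Finset (Fin n)) (l : Fin n), T ⊆ Sᶜ ∧ l ∈ T ∧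
        b ≤ ∑ i ∈ S, p i + ∑ i ∈ T, p i ∧
        ∑ i ∈ S, p i + ∑ i ∈ T.erase l, p i < b ∧
        ∑ i ∈ T, c i ≤ 2 * ∑ i ∈ Sᶜ, c i * xb i := by
  intro k
  induction k with
  | zero =>
    intro S c hk hS _
    have h := hKC S hS
    rw [Finset.card_eq_zero.mp hk] at h
    simp only [Finset.sum_empty] at h
    linarith
  | succ k ih =>
    intro S c hk hS hc
    have h := hKC S hS
    set β := b - ∑ i ∈ S, p i with hβ
    have hne : (Sᶜ.filter (fun i => 0 < p i)).Nonempty := by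
      by_contra hcon
      have hz : ∑ i ∈ Sᶜ, min (p i) β * xb i ≤ 0 := by
        apply Finset.sum_nonpos
        intro i hi
        have : ¬ 0 < p i := fun h0 => hcon ⟨i, by simp [h0, Finset.mem_compl.mp hi]⟩
        have h1 : min (p i) β ≤ 0 := (min_le_left _ _).trans (not_lt.mp this)
        exact mul_nonpos_of_nonpos_of_nonneg h1 (hxb i).1
      linarith
    obtain ⟨i, hi, hmin⟩ := Finset.exists_min_image _ (fun i => c i / min (p i) β) hne
    rw [Finset.mem_filter] at hi
    obtain ⟨hiS, hpi⟩ := hi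
    have hmi : 0 < min (p i) β := lt_min hpi hS
    set y := c i / min (p i) β with hy
    have hy0 : 0 ≤ y := div_nonneg (hc i hiS) hmi.le
    have hyi : c i = y * min (p i) β := by rw [hy]; field_simp
    have hc2 : ∀ j ∈ Sᶜ, 0 ≤ c j - y * min (p j) β := by
      intro j hj
      by_cases hpj : 0 < p j
      · have h1 := hmin j (Finset.mem_filter.mpr ⟨hj, hpj⟩)
        have h2 := (le_div_iff₀ (lt_min hpj hS)).mp h1
        linarith
      · have : p j = 0 := le_antisymm (not_lt.mp hpj) (hp j)
        rw [this, min_eq_left hS.le]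
        simpa using hc j hj
    have hsplit : ∑ j ∈ Sᶜ, c j * xb j = ∑ j ∈ Sᶜ, (c j - y * min (p j) β) * xb j
        + y * ∑ j ∈ Sᶜ, min (p j) β * xb j := by
      rw [Finset.mul_sum, ← Finset.sum_add_distrib]
      exact Finset.sum_congr rfl fun j _ => by ring
    have hyb : y * β ≤ y * ∑ j ∈ Sᶜ, min (p j) β * xb j := mul_le_mul_of_nonneg_left h hy0
    have hiS' : i ∉ S := Finset.mem_compl.mp hiS
    have hins : ∑ j ∈ insert i S, p j = p i + ∑ j ∈ S, p j := Finset.sum_insert hiS'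
    have hyb0 : 0 ≤ y * β := mul_nonneg hy0 hS.le
    by_cases hfe : b ≤ ∑ j ∈ S, p j + p i
    · refine ⟨{i}, i, by simpa using hiS', by simp, by simpa using hfe, by simp; linarith, ?_⟩
      have h3 : 0 ≤ ∑ j ∈ Sᶜ, (c j - y * min (p j) β) * xb j :=
        Finset.sum_nonneg fun j hj => mul_nonneg (hc2 j hj) (hxb j).1
      have h4 : y * min (p i) β ≤ y * β := mul_le_mul_of_nonneg_left (min_le_right _ _) hy0
      rw [Finset.sum_singleton]
      linarith
    · have hcomp : (insert i S)ᶜ = Sᶜ.erase i := Finset.compl_insert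
      obtain ⟨T, l, hT, hl, hf, hnf, hcost⟩ := ih (insert i S)
        (fun j => c j - y * min (p j) β)
        (by rw [hcomp, Finset.card_erase_of_mem hiS, hk]; rfl)
        (by rw [hins]; linarith)
        (by intro j hj; rw [hcomp] at hj; exact hc2 j (Finset.mem_of_mem_erase hj))
      rw [hcomp] at hT hcost
      rw [hins] at hf hnf
      have hiT : i ∉ T := fun hh => Finset.notMem_erase i _ (hT hh)
      have hli : l ≠ i := fun hh => hiT (hh ▸ hl)
      have herase : (insert i T).erase l = insert i (T.erase l) :=
        Finset.erase_insert_of_ne hli.symm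
      have hiTe : i ∉ T.erase l := fun hh => hiT (Finset.mem_of_mem_erase hh)
      refine ⟨insert i T, l, ?_, Finset.mem_insert_of_mem hl, ?_, ?_, ?_⟩
      · exact Finset.insert_subset hiS (hT.trans (Finset.erase_subset _ _))
      · rw [Finset.sum_insert hiT]; linarith
      · rw [herase, Finset.sum_insert hiTe]; linarith
      · have e1 : ∑ j ∈ T, c j = ∑ j ∈ T, (c j - y * min (p j) β)
            + y * ∑ j ∈ T, min (p j) β := by
          rw [Finset.mul_sum, ← Finset.sum_add_distrib]
          exact Finset.sum_congr rfl fun j _ => by ring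
        have e2 : ∑ j ∈ T, min (p j) β ≤ ∑ j ∈ T.erase l, p j + β := by
          rw [← Finset.sum_erase_add _ _ hl]
          exact add_le_add (Finset.sum_le_sum fun j _ => min_le_left _ _) (min_le_right _ _)
        have e3 : min (p i) β + ∑ j ∈ T, min (p j) β ≤ 2 * β := by
          have := min_le_left (p i) β
          linarith
        have e4 := mul_le_mul_of_nonneg_left e3 hy0
        have e5 : ∑ j ∈ Sᶜ.erase i, (c j - y * min (p j) β) * xb j
            ≤ ∑ j ∈ Sᶜ, (c j - y * min (p j) β) * xb j :=
          Finset.sum_le_sum_of_subset_of_nonneg (Finset.erase_subset _ _)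
            fun j hj _ => mul_nonneg (hc2 j hj) (hxb j).1
        rw [Finset.sum_insert hiT]
        rw [mul_add] at e4
        linarith

theorem stmt_14 (n : ℕ) (p : Fin n → ℝ) (hp : ∀ i, 0 ≤ p i)
    (b : ℝ) (hb : 0 < b)
    (c : Fin n → ℝ) (hc : ∀ i, 0 ≤ c i)
    (xb : Fin n → ℝ) (hxb : ∀ i, 0 ≤ xb i ∧ xb i ≤ 1)
    -- xb satisfies every knapsack cover inequality
    (hKC : ∀ S : Finset (Fin n), 0 < b - ∑ i ∈ S, p i →
      b - ∑ i ∈ S, p i ≤ ∑ i ∈ Sᶜ, min (p i) (b - ∑ j ∈ S, p j) * xb i) :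
    -- then some integral feasible solution costs at most twice as much as xb
    ∃ x : Fin n → ℝ, (∀ i, x i = 0 ∨ x i = 1) ∧ b ≤ ∑ i, p i * x i ∧
      ∑ i, c i * x i ≤ 2 * ∑ i, c i * xb i := by
  obtain ⟨T, l, -, -, hf, -, hcost⟩ := kc_aux n p hp b xb hxb hKC _ ∅ c rfl (by simpa using hb)
    (fun i _ => hc i)
  refine ⟨fun i => if i ∈ T then 1 else 0, fun i => ?_, ?_, ?_⟩
  · by_cases h : i ∈ T <;> simp [h]
  · simpa using hf
  · simpa using hcost
end

section
/- Let I ⊆ [n] with β := 1 − ∑_{i∈[n]∖I} p_i > 0. Call a subset J ⊆ I massive if ∑_{i∈J} p_i ≥ β. Then for every α ∈ ℝ^I with α ≥ 0, the following are equivalent: (a) ∑_{i∈I} α_i x_i ≥ 1 holds for every x ∈ K; (b) ∑_{i∈J} α_i ≥ 1 for every massive subset J ⊆ I. -/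
open Finset

theorem stmt_15 (n : ℕ) (p : Fin n → ℝ) (hp : ∀ i, 0 ≤ p i ∧ p i ≤ 1)
    (I : Finset (Fin n)) (β : ℝ) (hβ : β = 1 - ∑ i ∈ Iᶜ, p i) (hβpos : 0 < β)
    (α : Fin n → ℝ) (hα : ∀ i, 0 ≤ α i) :
    -- (a) ∑_{i∈I} α i * x i ≥ 1 is valid for K  ↔
    -- (b) ∑_{i∈J} α i ≥ 1 for every massive J ⊆ I
    ((∀ x : Fin n → ℝ, (∀ i, x i = 0 ∨ x i = 1) → 1 ≤ ∑ i, p i * x i →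
        1 ≤ ∑ i ∈ I, α i * x i) ↔
      (∀ J ⊆ I, β ≤ ∑ i ∈ J, p i → 1 ≤ ∑ i ∈ J, α i)) := by
  have key : ∀ (f x : Fin n → ℝ) (J : Finset (Fin n)), J ⊆ I → (∀ i ∈ J, x i = 1) →
      (∀ i ∈ I, i ∉ J → x i = 0) → ∑ i ∈ I, f i * x i = ∑ i ∈ J, f i := by
    intro f x J hJ h1 h0
    rw [← Finset.sum_subset hJ (f := fun i => f i * x i)]
    · exact Finset.sum_congr rfl fun i hi => by rw [h1 i hi, mul_one]
    · intro i hi hiJ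
      rw [h0 i hi hiJ, mul_zero]
  constructor
  · intro h J hJ hm
    let x : Fin n → ℝ := fun i => if i ∈ I ∧ i ∉ J then 0 else 1
    have h1 : ∀ i ∈ J, x i = 1 := fun i hi => by simp [x, hi]
    have h0 : ∀ i ∈ I, i ∉ J → x i = 0 := fun i hi hj => by simp [x, hi, hj]
    have := h x (fun i => by by_cases c : i ∈ I ∧ i ∉ J <;> simp [x, c]) ?_
    · rwa [key α x J hJ h1 h0] at this
    · rw [← Finset.sum_add_sum_compl I, key p x J hJ h1 h0]
      have : ∑ i ∈ Iᶜ, p i * x i = ∑ i ∈ Iᶜ, p i :=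
        Finset.sum_congr rfl fun i hi => by
          have : i ∉ I := Finset.mem_compl.1 hi
          simp [x, this]
      linarith
  · intro h x hx hk
    have h1 : ∀ i ∈ I.filter (fun i => x i = 1), x i = 1 := fun i hi => (Finset.mem_filter.1 hi).2
    have h0 : ∀ i ∈ I, i ∉ I.filter (fun i => x i = 1) → x i = 0 := fun i hi hj =>
      (hx i).resolve_right fun c => hj (Finset.mem_filter.2 ⟨hi, c⟩)
    have hs := Finset.filter_subset (fun i => x i = 1) I
    rw [key α x _ hs h1 h0]
    apply h _ hs
    rw [← Finset.sum_add_sum_compl I, key p x _ hs h1 h0] at hk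
    have : ∑ i ∈ Iᶜ, p i * x i ≤ ∑ i ∈ Iᶜ, p i :=
      Finset.sum_le_sum fun i _ => by
        have := (hp i).1
        rcases hx i with c | c <;> simp [c, this]
    linarith
end

section
/- Let n ≥ 4, ε_n := 1/√n, and F_n := {(x,z) ∈ {0,1}^n × {0,1}^n : ∑_{i=1}^n x_i + (1/n)∑_{j=1}^n z_j ≥ 1 + ε_n}. Let ∑_{i∈I} w_i x_i + ∑_{j∈J} w_j z_j ≥ β be a valid inequality for F_n with support I ∪ J (so w_i > 0 for i ∈ I, w_j > 0 for j ∈ J) and β > 0. Then |I| ≥ n−1; moreover, if |I| = n−1 or |J| ≤ n(1−ε_n), then w_i ≥ β for all i ∈ I. -/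
open Finset

theorem stmt_17 (n : ℕ) (hn : 4 ≤ n)
    (I J : Finset (Fin n)) (wx wz : Fin n → ℝ) (β : ℝ)
    (hwx : ∀ i ∈ I, 0 < wx i) (hwz : ∀ j ∈ J, 0 < wz j) (hβ : 0 < β)
    -- ∑_{i∈I} wx i * x i + ∑_{j∈J} wz j * z j ≥ β is valid for
    -- F_n = {(x,z) ∈ {0,1}^n × {0,1}^n : ∑ x_i + (1/n) ∑ z_j ≥ 1 + 1/√n}
    (hvalid : ∀ x z : Fin n → ℝ, (∀ i, x i = 0 ∨ x i = 1) → (∀ j, z j = 0 ∨ z j = 1) →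
      1 + 1 / Real.sqrt n ≤ ∑ i, x i + (1 / (n : ℝ)) * ∑ j, z j →
      β ≤ ∑ i ∈ I, wx i * x i + ∑ j ∈ J, wz j * z j) :
    -- then |I| ≥ n − 1, and moreover:
    n - 1 ≤ I.card ∧
    ((I.card = n - 1 ∨ (J.card : ℝ) ≤ (n : ℝ) * (1 - 1 / Real.sqrt n)) →
      ∀ i ∈ I, β ≤ wx i) := by
  have hn0 : (0:ℝ) < n := by
    have : 0 < n := by omega
    exact_mod_cast this
  have hs1 : 1 / Real.sqrt n ≤ 1 := by
    have h1 : (1:ℝ) ≤ Real.sqrt n := by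
      rw [Real.one_le_sqrt]
      have : 1 ≤ n := by omega
      exact_mod_cast this
    rw [div_le_one (by linarith)]
    exact h1
  have key : ∀ S T : Finset (Fin n),
      1 + 1 / Real.sqrt n ≤ (S.card : ℝ) + (1 / (n : ℝ)) * (T.card : ℝ) →
      β ≤ ∑ i ∈ I ∩ S, wx i + ∑ j ∈ J ∩ T, wz j := by
    intro S T h
    have := hvalid (fun i => if i ∈ S then 1 else 0) (fun j => if j ∈ T then 1 else 0)
      (fun i => by by_cases h : i ∈ S <;> simp [h])
      (fun i => by by_cases h : i ∈ T <;> simp [h])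
      (by simpa using h)
    simpa [Finset.sum_ite_mem] using this
  have hcard : I.card + (Iᶜ).card = n := by
    simpa using Finset.card_add_card_compl I
  have hI : n - 1 ≤ I.card := by
    by_contra hlt
    have h2 : (2:ℝ) ≤ (Iᶜ).card := by
      have : 2 ≤ (Iᶜ).card := by omega
      exact_mod_cast this
    have := key Iᶜ ∅ (by simp only [Finset.card_empty, Nat.cast_zero, mul_zero]; linarith)
    simp at this
    linarith
  refine ⟨hI, ?_⟩
  rintro (h | h) i hi
  · have h1 : (insert i Iᶜ).card = 2 := by
      rw [Finset.card_insert_of_notMem (by simpa using hi)]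
      omega
    have := key (insert i Iᶜ) ∅ (by
      rw [h1]; simp only [Finset.card_empty, Nat.cast_zero, mul_zero]; push_cast; linarith)
    rw [Finset.inter_insert_of_mem hi] at this
    simpa using this
  · have hJ : (J.card : ℝ) + ((Jᶜ).card : ℝ) = n := by
      have : J.card + (Jᶜ).card = n := by simpa using Finset.card_add_card_compl J
      exact_mod_cast this
    have := key {i} Jᶜ (by
      have h3 : (n:ℝ) * (1 / Real.sqrt n) ≤ ((Jᶜ).card : ℝ) := by linarith
      have h4 : 1 / Real.sqrt n ≤ (1 / (n:ℝ)) * ((Jᶜ).card : ℝ) := by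
        rw [one_div_mul_eq_div, le_div_iff₀ hn0]
        linarith
      simp only [Finset.card_singleton, Nat.cast_one]
      linarith)
    rw [Finset.inter_singleton_of_mem hi] at this
    simpa using this
end
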